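/- arXiv:1312.3619 — 4 statements merged into one kernel-verified Lean document; each statement's English description precedes it below -/
import Mathlib

section
/- Let φ : X → ℝ be a locally Hölder potential on X = [0,1]∖ℚ with P(φ) = 0, 𝓛_φ1 = 1 and φ ≤ 0, let μ_φ be its Gibbs measure, ψ = −log|T′|, and s the Hausdorff dimension of μ_φ. Then the following are equivalent: (i) there exists δ > 0 such that μ_φ({x ∈ X : a₁(x) ≥ n}) = O(n^{−δ}) as n → ∞; (ii) there exists t₀ > 0 such that for all −t₀ < t < t₀ both P(tψ + φ) < ∞ and P(t(φ − sψ) + φ) < ∞. -/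
open MeasureTheory Filter Set Topology
open scoped ENNReal NNReal Classical Real

noncomputable section

/-- The Gauss map `T(x) = 1/x mod 1`. -/
def gaussMap (x : ℝ) : ℝ := Int.fract x⁻¹

/-- The space `X = [0,1] ∖ ℚ` of irrational numbers in the unit interval. -/
def gaussSet : Set ℝ := {x | x ∈ Set.Icc (0:ℝ) 1 ∧ Irrational x}

/-- The first continued fraction digit `a₁(x) = ⌊1/x⌋`. -/
def cfDigit1 (x : ℝ) : ℕ := ⌊x⁻¹⌋₊

/-- The `(i+1)`-th continued fraction digit `a_{i+1}(x) = a₁(Tⁱ x)`. -/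
def cfDigit (i : ℕ) (x : ℝ) : ℕ := cfDigit1 (gaussMap^[i] x)

/-- The inverse branch `T_a(x) = 1/(x+a)` of the Gauss map. -/
def invBranch1 (a : ℕ) (x : ℝ) : ℝ := (x + (a : ℝ))⁻¹

/-- The composed inverse branch `T_𝐚 = T_{a₁} ∘ ⋯ ∘ T_{aₙ}` for `𝐚 = [a₁,…,aₙ]`. -/
def invBranch (l : List ℕ) (x : ℝ) : ℝ := l.foldr invBranch1 x

/-- The cylinder set `I_𝐚` of points of `X` whose first digits are given by `𝐚`. -/
def cylinder (l : List ℕ) : Set ℝ :=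
  {x | x ∈ gaussSet ∧ ∀ i : Fin l.length, cfDigit i.1 x = l.get i}

/-- The Birkhoff sum `S_n φ = ∑_{k<n} φ ∘ T^k`. -/
def birkhoff (φ : ℝ → ℝ) (n : ℕ) (x : ℝ) : ℝ :=
  ∑ k ∈ Finset.range n, φ (gaussMap^[k] x)

/-- The pair `(pₙ(𝐚), qₙ(𝐚))` of numerator and denominator (continuant) of the
finite continued fraction `[a₁,…,aₙ] = pₙ/qₙ`. -/
def contPQ : List ℕ → ℕ × ℕ
  | [] => (0, 1)
  | a :: l => ((contPQ l).2, a * (contPQ l).2 + (contPQ l).1)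

/-- The continuant `qₙ(𝐚)`, the denominator of `[a₁,…,aₙ]` in lowest terms. -/
def contQ (l : List ℕ) : ℕ := (contPQ l).2

/-- Words of length `n` with digits in `ℕ = {1,2,…}`. -/
def Word (n : ℕ) : Type := {l : List ℕ // l.length = n ∧ ∀ a ∈ l, 0 < a}

/-- The periodic point `𝐚^∞` with periodic continued fraction expansion repeating `𝐚`. -/
def periodicPoint (l : List ℕ) : ℝ :=
  limUnder atTop fun k : ℕ => invBranch (List.flatten (List.replicate k l)) (1/2 : ℝ)

/-- The `n`-th partition sum `∑_{𝐚 ∈ ℕⁿ} exp(S_nφ(𝐚^∞))` appearing in the pressure. -/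
def partSum (φ : ℝ → ℝ) (n : ℕ) : ℝ≥0∞ :=
  ∑' l : Word n, ENNReal.ofReal (Real.exp (birkhoff φ n (periodicPoint l.1)))

/-- `φ` has (finite) pressure `P(φ) = p`, i.e. `(1/n) log ∑_{𝐚∈ℕⁿ} exp(S_nφ(𝐚^∞)) → p`. -/
def HasPressure (φ : ℝ → ℝ) (p : ℝ) : Prop :=
  (∀ n : ℕ, 0 < n → partSum φ n ≠ ⊤) ∧
    Tendsto (fun n : ℕ => Real.log (partSum φ n).toReal / (n : ℝ)) atTop (𝓝 p)

/-- The pressure of `φ` is finite: `P(φ) < ∞`. -/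
def PressureFinite (φ : ℝ → ℝ) : Prop := ∃ p : ℝ, HasPressure φ p

/-- `φ` is locally Hölder: oscillation on `n`-cylinders decays geometrically. -/
def LocHolder (φ : ℝ → ℝ) : Prop :=
  ∃ C > (0:ℝ), ∃ θ ∈ Set.Ioo (0:ℝ) 1, ∀ l : List ℕ, l ≠ [] → (∀ a ∈ l, 0 < a) →
    ∀ x ∈ cylinder l, ∀ y ∈ cylinder l, |φ x - φ y| ≤ C * θ ^ l.length

/-- The normalization `𝓛_φ 1 = 1` of the Ruelle transfer operator of `φ`. -/
def TransferNormalized (φ : ℝ → ℝ) : Prop :=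
  ∀ x ∈ gaussSet, ∑' a : ℕ+, Real.exp (φ (invBranch1 (a : ℕ) x)) = 1

/-- `μ` is invariant under the Gauss map. -/
def GaussInvariant (μ : Measure ℝ) : Prop :=
  ∀ s : Set ℝ, MeasurableSet s → μ (gaussMap ⁻¹' s) = μ s

/-- The Gibbs property for the potential `φ` (with `P(φ) = 0`):
`C⁻¹ e^{S_nφ(T_𝐚 x)} ≤ μ(I_𝐚) ≤ C e^{S_nφ(T_𝐚 x)}`. -/
def IsGibbs (φ : ℝ → ℝ) (μ : Measure ℝ) : Prop :=
  ∃ C : ℝ, 1 ≤ C ∧ ∀ l : List ℕ, l ≠ [] → (∀ a ∈ l, 0 < a) → ∀ x ∈ gaussSet,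
    C⁻¹ * Real.exp (birkhoff φ l.length (invBranch l x)) ≤ (μ (cylinder l)).toReal ∧
      (μ (cylinder l)).toReal ≤ C * Real.exp (birkhoff φ l.length (invBranch l x))

/-- The Kolmogorov–Sinai entropy of `μ`:
`h = lim (1/n) ∑_{𝐚∈ℕⁿ} -μ(I_𝐚) log μ(I_𝐚)`. -/
def HasEntropy (μ : Measure ℝ) (h : ℝ) : Prop :=
  Tendsto (fun n : ℕ => (∑' l : Word n, Real.negMulLog (μ (cylinder l.1)).toReal) / (n : ℝ))
    atTop (𝓝 h)

/-- `log |T'| (x) = log (1/x²)` for the Gauss map. -/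
def logAbsDerivGauss (x : ℝ) : ℝ := Real.log (1 / x ^ 2)

/-- The observable `ψ = -log |T'|`. -/
def gaussPsi (x : ℝ) : ℝ := -Real.log (1 / x ^ 2)

/-- The Lyapunov exponent `λ_μ = ∫ log|T'| dμ`. -/
def lyapunov (μ : Measure ℝ) : ℝ := ∫ x, logAbsDerivGauss x ∂μ

/-- The polynomial tail condition `μ({x : a₁(x) ≥ n}) = O(n^{-δ})`. -/
def PolyTail (μ : Measure ℝ) : Prop :=
  ∃ δ > (0:ℝ), ∃ K : ℝ, ∀ n : ℕ, 0 < n →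
    (μ {x | x ∈ gaussSet ∧ n ≤ cfDigit1 x}).toReal ≤ K * (n : ℝ) ^ (-δ)

/-- The Fourier transform `μ̂(ξ) = ∫ e^{-2πiξx} dμ(x)`. -/
def muFourier (μ : Measure ℝ) (ξ : ℝ) : ℂ :=
  ∫ x, Complex.exp (-(2 * Real.pi * ξ * x : ℝ) * Complex.I) ∂μ

/-- A sequence `u` equidistributes modulo 1. -/
def EquidistributedMod1 (u : ℕ → ℝ) : Prop :=
  ∀ a b : ℝ, 0 ≤ a → a ≤ b → b ≤ 1 →
    Tendsto (fun N : ℕ =>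
        (((Finset.range N).filter fun k => Int.fract (u k) ∈ Set.Ico a b).card : ℝ) / (N : ℝ))
      atTop (𝓝 (b - a))

/-- The set `B(𝒜)` of `𝒜`-badly approximable numbers: all digits lie in `𝒜`. -/
def badSet (A : Finset ℕ) : Set ℝ := {x | x ∈ gaussSet ∧ ∀ i : ℕ, cfDigit i x ∈ A}

/-- Locally Hölder on the subsystem `B(𝒜)`. -/
def LocHolderOn (A : Finset ℕ) (φ : ℝ → ℝ) : Prop :=
  ∃ C > (0:ℝ), ∃ θ ∈ Set.Ioo (0:ℝ) 1, ∀ l : List ℕ, l ≠ [] → (∀ a ∈ l, a ∈ A) →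
    ∀ x ∈ cylinder l ∩ badSet A, ∀ y ∈ cylinder l ∩ badSet A,
      |φ x - φ y| ≤ C * θ ^ l.length

/-- The Gibbs property for the Gauss map restricted to `B(𝒜)`. -/
def IsGibbsOn (A : Finset ℕ) (φ : ℝ → ℝ) (μ : Measure ℝ) : Prop :=
  ∃ C : ℝ, 1 ≤ C ∧ ∀ l : List ℕ, l ≠ [] → (∀ a ∈ l, a ∈ A) → ∀ x ∈ badSet A,
    C⁻¹ * Real.exp (birkhoff φ l.length (invBranch l x)) ≤ (μ (cylinder l)).toReal ∧
      (μ (cylinder l)).toReal ≤ C * Real.exp (birkhoff φ l.length (invBranch l x))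

/-- The `n`-regular set `A_n(ε)` of the large deviation decomposition. -/
def regSet (φ : ℝ → ℝ) (lam s ε : ℝ) (n : ℕ) : Set ℝ :=
  {x | |birkhoff gaussPsi n x / (n : ℝ) + lam| < ε ∧
       |birkhoff φ n x / birkhoff gaussPsi n x - s| < ε}

/-- The collection `𝓡ₙ` of `n`-regular words. -/
def regWords (φ : ℝ → ℝ) (lam s ε : ℝ) (n : ℕ) : Set (List ℕ) :=
  {l | l.length = n ∧ (∀ a ∈ l, 0 < a) ∧
       ∀ k : ℕ, n / 2 ≤ k → k ≤ n → cylinder (l.take k) ⊆ regSet φ lam s ε k}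

/-- The union `Rₙ` of the `n`-regular cylinders. -/
def regUnion (φ : ℝ → ℝ) (lam s ε : ℝ) (n : ℕ) : Set ℝ :=
  ⋃ l ∈ regWords φ lam s ε n, cylinder l

end

/-! ### Inverse branches and cylinders -/

lemma mem_gaussSet_iff {x : ℝ} : x ∈ gaussSet ↔ 0 < x ∧ x < 1 ∧ Irrational x := by
  constructor
  · rintro ⟨⟨h0, h1⟩, hx⟩
    exact ⟨lt_of_le_of_ne h0 hx.ne_zero.symm, lt_of_le_of_ne h1 hx.ne_one, hx⟩
  · rintro ⟨h0, h1, hx⟩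
    exact ⟨⟨h0.le, h1.le⟩, hx⟩

lemma cfDigit1_pos {x : ℝ} (hx : x ∈ gaussSet) : 0 < cfDigit1 x := by
  obtain ⟨h0, h1, -⟩ := mem_gaussSet_iff.1 hx
  exact Nat.floor_pos.2 (one_le_inv₀ h0 |>.2 h1.le)

lemma gaussMap_eq {x : ℝ} (hx : x ∈ gaussSet) : gaussMap x = x⁻¹ - cfDigit1 x := by
  obtain ⟨h0, -, -⟩ := mem_gaussSet_iff.1 hx
  rw [gaussMap, cfDigit1, Int.fract, natCast_floor_eq_intCast_floor (inv_nonneg.2 h0.le)]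

lemma gaussMap_mem {x : ℝ} (hx : x ∈ gaussSet) : gaussMap x ∈ gaussSet := by
  have hirr : Irrational (gaussMap x) := by
    rw [gaussMap_eq hx]
    exact hx.2.inv.sub_natCast _
  exact ⟨⟨Int.fract_nonneg _, (Int.fract_lt_one _).le⟩, hirr⟩

lemma invBranch1_gaussMap {x : ℝ} (hx : x ∈ gaussSet) :
    invBranch1 (cfDigit1 x) (gaussMap x) = x := by
  rw [invBranch1, gaussMap_eq hx]
  simp

lemma gaussMap_invBranch1 {y : ℝ} (h0 : 0 ≤ y) (h1 : y < 1) (a : ℕ) :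
    gaussMap (invBranch1 a y) = y := by
  rw [gaussMap, invBranch1, inv_inv, Int.fract_add_natCast]
  exact Int.fract_eq_self.2 ⟨h0, h1⟩

lemma cfDigit1_invBranch1 {y : ℝ} (h0 : 0 ≤ y) (h1 : y < 1) (a : ℕ) :
    cfDigit1 (invBranch1 a y) = a := by
  rw [cfDigit1, invBranch1, inv_inv, Nat.floor_add_natCast h0, Nat.floor_eq_zero.2 h1, zero_add]

lemma invBranch1_mem {y : ℝ} (hy : y ∈ gaussSet) {a : ℕ} (ha : 0 < a) :
    invBranch1 a y ∈ gaussSet := by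
  obtain ⟨h0, h1, hirr⟩ := mem_gaussSet_iff.1 hy
  have ha' : (1 : ℝ) ≤ a := by exact_mod_cast ha
  refine mem_gaussSet_iff.2 ⟨?_, ?_, ?_⟩
  · unfold invBranch1; positivity
  · unfold invBranch1; exact inv_lt_one_of_one_lt₀ (by linarith)
  · exact (hirr.add_natCast a).inv

lemma mem_cylinder_nil {x : ℝ} : x ∈ cylinder [] ↔ x ∈ gaussSet := by
  simp [_root_.cylinder]

lemma mem_cylinder_cons {a : ℕ} {l : List ℕ} {x : ℝ} :
    x ∈ cylinder (a :: l) ↔ x ∈ gaussSet ∧ cfDigit1 x = a ∧ gaussMap x ∈ cylinder l := by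
  constructor
  · rintro ⟨hx, h⟩
    exact ⟨hx, h ⟨0, by simp⟩, gaussMap_mem hx, fun i => h i.succ⟩
  · rintro ⟨hx, h0, -, h⟩
    exact ⟨hx, Fin.cases h0 h⟩

lemma mem_cylinder_append {l m : List ℕ} {x : ℝ} (hx : x ∈ cylinder (l ++ m)) :
    x ∈ cylinder l ∧ gaussMap^[l.length] x ∈ cylinder m := by
  induction l generalizing x with
  | nil => exact ⟨mem_cylinder_nil.2 hx.1, hx⟩
  | cons a l ih =>
    rw [List.cons_append, mem_cylinder_cons] at hx
    exact ⟨mem_cylinder_cons.2 ⟨hx.1, hx.2.1, (ih hx.2.2).1⟩, (ih hx.2.2).2⟩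

lemma invBranch_mem_cylinder {l : List ℕ} (hl : ∀ a ∈ l, 0 < a) {y : ℝ} (hy : y ∈ gaussSet) :
    invBranch l y ∈ cylinder l := by
  induction l with
  | nil => exact mem_cylinder_nil.2 hy
  | cons a l ih =>
    have h := ih fun b hb => hl b (List.mem_cons_of_mem _ hb)
    obtain ⟨h0, h1, -⟩ := mem_gaussSet_iff.1 h.1
    refine mem_cylinder_cons.2 ⟨invBranch1_mem h.1 (hl a (by simp)), ?_, ?_⟩
    · exact cfDigit1_invBranch1 h0.le h1 a
    · rw [show invBranch (a :: l) y = invBranch1 a (invBranch l y) from rfl,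
        gaussMap_invBranch1 h0.le h1]
      exact h

lemma exists_eq_invBranch {l : List ℕ} {x : ℝ} (hx : x ∈ cylinder l) :
    ∃ y ∈ gaussSet, x = invBranch l y := by
  induction l generalizing x with
  | nil => exact ⟨x, hx.1, rfl⟩
  | cons a l ih =>
    obtain ⟨h, h0, h1⟩ := mem_cylinder_cons.1 hx
    obtain ⟨y, hy, hxy⟩ := ih h1
    refine ⟨y, hy, ?_⟩
    rw [show invBranch (a :: l) y = invBranch1 a (invBranch l y) from rfl, ← hxy, ← h0,
      invBranch1_gaussMap h]

lemma pos_of_mem_cylinder {l : List ℕ} {x : ℝ} (hx : x ∈ cylinder l) : ∀ a ∈ l, 0 < a := by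
  induction l generalizing x with
  | nil => simp
  | cons a l ih =>
    obtain ⟨h, h0, h1⟩ := mem_cylinder_cons.1 hx
    simpa [← h0, cfDigit1_pos h] using ih h1

/-! ### Contraction of the inverse branches and periodic points -/

lemma invBranch1_mem_Icc {a : ℕ} (ha : 0 < a) {x : ℝ} (hx : x ∈ Icc (0 : ℝ) 1) :
    invBranch1 a x ∈ Icc (0 : ℝ) 1 := by
  have ha' : (1 : ℝ) ≤ a := by exact_mod_cast ha
  have := hx.1
  exact ⟨by unfold invBranch1; positivity, inv_le_one_of_one_le₀ (by linarith)⟩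

lemma invBranch_mem_Icc {l : List ℕ} (hl : ∀ a ∈ l, 0 < a) {x : ℝ} (hx : x ∈ Icc (0 : ℝ) 1) :
    invBranch l x ∈ Icc (0 : ℝ) 1 := by
  induction l with
  | nil => exact hx
  | cons a l ih =>
    exact invBranch1_mem_Icc (hl a (by simp)) (ih fun b hb => hl b (List.mem_cons_of_mem _ hb))

lemma invBranch1_sub {a : ℕ} (ha : 0 < a) {x y : ℝ} (hx : 0 ≤ x) (hy : 0 ≤ y) :
    |invBranch1 a x - invBranch1 a y| = |x - y| * (invBranch1 a x * invBranch1 a y) := by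
  have ha' : (0 : ℝ) < a := by exact_mod_cast ha
  unfold invBranch1
  have h : (x + a)⁻¹ - (y + a)⁻¹ = -(x - y) * ((x + a)⁻¹ * (y + a)⁻¹) := by
    field_simp
    ring
  rw [h, abs_mul, abs_neg, abs_of_nonneg (a := (x + a)⁻¹ * (y + a)⁻¹) (by positivity)]

lemma abs_invBranch_sub_le (l : List ℕ) (hl : ∀ a ∈ l, 0 < a) {x y : ℝ}
    (hx : x ∈ Icc (0 : ℝ) 1) (hy : y ∈ Icc (0 : ℝ) 1) :
    |invBranch l x - invBranch l y| ≤ 2 * (1 / 2) ^ l.length * |x - y| := by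
  match l with
  | [] => simp [invBranch]; linarith [abs_nonneg (x - y)]
  | [a] =>
    have ha := hl a (by simp)
    have h1 := invBranch1_mem_Icc ha hx
    have h2 := invBranch1_mem_Icc ha hy
    change |invBranch1 a x - invBranch1 a y| ≤ _
    rw [invBranch1_sub ha hx.1 hy.1]
    have := mul_le_one₀ h1.2 h2.1 h2.2
    simpa using mul_le_of_le_one_right (abs_nonneg (x - y)) this
  | a :: b :: l =>
    have ha := hl a (by simp)
    have hb := hl b (by simp)
    have hl' : ∀ c ∈ l, 0 < c := fun c hc => hl c (by simp [hc])
    have ih := abs_invBranch_sub_le l hl' hx hy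
    have hu := invBranch_mem_Icc hl' hx
    have hv := invBranch_mem_Icc hl' hy
    change |invBranch1 a (invBranch1 b (invBranch l x)) -
      invBranch1 a (invBranch1 b (invBranch l y))| ≤ _
    set u := invBranch l x
    set v := invBranch l y
    have key : ∀ w ∈ Icc (0 : ℝ) 1,
        0 ≤ invBranch1 b w * invBranch1 a (invBranch1 b w) ∧
        invBranch1 b w * invBranch1 a (invBranch1 b w) ≤ 1 / 2 := by
      intro w hw
      obtain ⟨h0, h1⟩ := invBranch1_mem_Icc hb hw
      have h2 := invBranch1_mem_Icc ha ⟨h0, h1⟩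
      refine ⟨mul_nonneg h0 h2.1, ?_⟩
      have ha' : (1 : ℝ) ≤ a := by exact_mod_cast ha
      rw [show invBranch1 a (invBranch1 b w) = (invBranch1 b w + a)⁻¹ from rfl,
        ← div_eq_mul_inv, div_le_div_iff₀ (by linarith) (by norm_num)]
      linarith
    rw [invBranch1_sub ha (invBranch1_mem_Icc hb hu).1 (invBranch1_mem_Icc hb hv).1,
      invBranch1_sub hb hu.1 hv.1]
    calc _ = |u - v| * ((invBranch1 b u * invBranch1 a (invBranch1 b u)) *
          (invBranch1 b v * invBranch1 a (invBranch1 b v))) := by ring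
      _ ≤ (2 * (1 / 2) ^ l.length * |x - y|) * (1 / 2 * (1 / 2)) := by
        obtain ⟨h1, h2⟩ := key u hu
        obtain ⟨h3, h4⟩ := key v hv
        gcongr
      _ = _ := by simp only [List.length_cons]; ring

lemma invBranch_append (l m : List ℕ) (x : ℝ) :
    invBranch (l ++ m) x = invBranch l (invBranch m x) := by
  simp [invBranch]

lemma continuousOn_invBranch {l : List ℕ} (hl : ∀ a ∈ l, 0 < a) :
    ContinuousOn (invBranch l) (Icc 0 1) := by
  refine LipschitzOnWith.continuousOn (K := 2) (LipschitzOnWith.of_dist_le_mul ?_)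
  intro x hx y hy
  refine (abs_invBranch_sub_le l hl hx hy).trans ?_
  rw [Real.dist_eq]
  have : ((1 : ℝ) / 2) ^ l.length ≤ 1 := pow_le_one₀ (by norm_num) (by norm_num)
  push_cast
  gcongr
  linarith

lemma pos_of_mem_flatten_replicate {l : List ℕ} (hl : ∀ a ∈ l, 0 < a) (k : ℕ) :
    ∀ a ∈ (List.replicate k l).flatten, 0 < a := by
  intro a ha
  obtain ⟨m, hm, ham⟩ := List.mem_flatten.1 ha
  exact hl a (List.eq_of_mem_replicate hm ▸ ham)

lemma tendsto_periodicPoint {l : List ℕ} (hne : l ≠ []) (hl : ∀ a ∈ l, 0 < a) :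
    Tendsto (fun k : ℕ => invBranch (List.flatten (List.replicate k l)) (1 / 2 : ℝ)) atTop
      (𝓝 (periodicPoint l)) := by
  refine CauchySeq.tendsto_limUnder (cauchySeq_of_le_geometric (1 / 2) 2 (by norm_num) ?_)
  intro k
  have hpos := pos_of_mem_flatten_replicate hl k
  have hhalf : (1 / 2 : ℝ) ∈ Icc (0 : ℝ) 1 := by constructor <;> norm_num
  have hmem := invBranch_mem_Icc hl hhalf
  rw [List.replicate_succ', List.flatten_append, invBranch_append, Real.dist_eq]
  simp only [List.flatten_cons, List.flatten_nil, List.append_nil]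
  refine (abs_invBranch_sub_le _ hpos hhalf hmem).trans ?_
  have h1 : |1 / 2 - invBranch l (1 / 2)| ≤ 1 := by
    rw [abs_le]; constructor <;> linarith [hmem.1, hmem.2]
  have h2 : k ≤ (List.replicate k l).flatten.length := by
    have : 0 < l.length := List.length_pos_of_ne_nil hne
    simp only [List.length_flatten, List.map_replicate, List.sum_replicate, smul_eq_mul]
    exact Nat.le_mul_of_pos_right k this
  have h3 : ((1 : ℝ) / 2) ^ (List.replicate k l).flatten.length ≤ (1 / 2) ^ k :=
    pow_le_pow_of_le_one (by norm_num) (by norm_num) h2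
  calc _ ≤ 2 * (1 / 2 : ℝ) ^ k * 1 := by gcongr
    _ = _ := mul_one _

lemma periodicPoint_mem_Icc {l : List ℕ} (hne : l ≠ []) (hl : ∀ a ∈ l, 0 < a) :
    periodicPoint l ∈ Icc (0 : ℝ) 1 := by
  refine isClosed_Icc.mem_of_tendsto (tendsto_periodicPoint hne hl) (Eventually.of_forall ?_)
  intro k
  exact invBranch_mem_Icc (pos_of_mem_flatten_replicate hl k) (by constructor <;> norm_num)

lemma invBranch_periodicPoint {l : List ℕ} (hne : l ≠ []) (hl : ∀ a ∈ l, 0 < a) :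
    invBranch l (periodicPoint l) = periodicPoint l := by
  have h := tendsto_periodicPoint hne hl
  have hw : Tendsto (fun k : ℕ => invBranch (List.flatten (List.replicate k l)) (1 / 2 : ℝ)) atTop
      (𝓝[Icc 0 1] (periodicPoint l)) := by
    refine tendsto_nhdsWithin_iff.2 ⟨h, Eventually.of_forall fun k => ?_⟩
    exact invBranch_mem_Icc (pos_of_mem_flatten_replicate hl k) (by constructor <;> norm_num)
  have h1 := (continuousOn_invBranch hl _ (periodicPoint_mem_Icc hne hl)).tendsto.comp hw
  refine tendsto_nhds_unique h1 ?_
  have h2 := h.comp (tendsto_add_atTop_nat 1)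
  refine h2.congr fun k => ?_
  simp [List.replicate_succ, invBranch_append]

lemma invBranch_pos {l : List ℕ} (hl : ∀ a ∈ l, 0 < a) {x : ℝ} (hx : 0 < x) :
    0 < invBranch l x := by
  induction l with
  | nil => exact hx
  | cons a l ih =>
    have := ih fun b hb => hl b (List.mem_cons_of_mem _ hb)
    change 0 < (invBranch l x + a)⁻¹
    positivity

/-- Inverse branches of the Gauss map strictly increase the denominator of a rational. -/
lemma exists_rat_invBranch {l : List ℕ} (hl : ∀ a ∈ l, 0 < a) {q : ℚ} (hq : 0 < q) :
    ∃ r : ℚ, 0 < r ∧ (r : ℝ) = invBranch l q ∧ q.den + l.length ≤ r.den := by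
  induction l with
  | nil => exact ⟨q, hq, rfl, le_rfl⟩
  | cons a l ih =>
    obtain ⟨r, hr0, hr, hden⟩ := ih fun b hb => hl b (List.mem_cons_of_mem _ hb)
    have ha : (1 : ℚ) ≤ a := by exact_mod_cast hl a (by simp)
    refine ⟨(r + a)⁻¹, by positivity, ?_, ?_⟩
    · push_cast
      rw [hr]
      rfl
    · have h1 : ¬ (r + a).num < ((r + a).den : ℤ) + 1 := by
        have h : ¬ (r + a) ≤ 1 := by linarith
        rw [Rat.le_iff] at h
        simp only [Rat.num_one, Rat.den_one] at h
        push_cast at h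
        linarith
      rw [Rat.den_inv_of_ne_zero (by positivity)]
      rw [Rat.add_natCast_den] at h1
      simp only [List.length_cons]
      omega

lemma periodicPoint_mem_gaussSet {l : List ℕ} (hne : l ≠ []) (hl : ∀ a ∈ l, 0 < a) :
    periodicPoint l ∈ gaussSet := by
  have hfix := invBranch_periodicPoint hne hl
  have hIcc := periodicPoint_mem_Icc hne hl
  refine ⟨hIcc, ?_⟩
  have hpos : 0 < periodicPoint l := by
    match l, hne with
    | a :: l, _ =>
      rw [← hfix]
      have ha : (0 : ℝ) < a := by exact_mod_cast hl a (by simp)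
      have := (invBranch_mem_Icc (l := l) (fun b hb => hl b (List.mem_cons_of_mem _ hb)) hIcc).1
      change 0 < (invBranch l _ + a)⁻¹
      positivity
  rintro ⟨q, hq⟩
  obtain ⟨r, -, hr, hden⟩ := exists_rat_invBranch hl (q := q) (by exact_mod_cast hq ▸ hpos)
  rw [hq, hfix, ← hq] at hr
  have hlen : 0 < l.length := List.length_pos_of_ne_nil hne
  rw [Rat.cast_injective hr] at hden
  omega

lemma periodicPoint_mem_cylinder {l : List ℕ} (hne : l ≠ []) (hl : ∀ a ∈ l, 0 < a) :
    periodicPoint l ∈ cylinder l := by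
  rw [← invBranch_periodicPoint hne hl]
  exact invBranch_mem_cylinder hl (periodicPoint_mem_gaussSet hne hl)

/-! ### Bounded distortion -/

lemma birkhoff_succ (g : ℝ → ℝ) (n : ℕ) (x : ℝ) :
    birkhoff g (n + 1) x = g x + birkhoff g n (gaussMap x) := by
  simp only [birkhoff, Finset.sum_range_succ', Function.iterate_succ_apply,
    Function.iterate_zero, id]
  ring

lemma birkhoff_add (g : ℝ → ℝ) (m n : ℕ) (x : ℝ) :
    birkhoff g (m + n) x = birkhoff g m x + birkhoff g n (gaussMap^[m] x) := by
  simp only [birkhoff, Finset.sum_range_add, ← Function.iterate_add_apply, add_comm]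

lemma LocHolder.exists_distortion {g : ℝ → ℝ} (hg : LocHolder g) :
    ∃ D : ℝ, 0 ≤ D ∧ ∀ l : List ℕ, ∀ x ∈ cylinder l, ∀ y ∈ cylinder l,
      |birkhoff g l.length x - birkhoff g l.length y| ≤ D := by
  obtain ⟨C, hC, θ, ⟨h0, h1⟩, hH⟩ := hg
  have h1' : 0 < 1 - θ := by linarith
  have key : ∀ l : List ℕ, ∀ x ∈ cylinder l, ∀ y ∈ cylinder l,
      |birkhoff g l.length x - birkhoff g l.length y| ≤ C / (1 - θ) * (1 - θ ^ l.length) := by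
    intro l
    induction l with
    | nil => simp [birkhoff]
    | cons a l ih =>
      intro x hx y hy
      have h := hH (a :: l) (by simp) (pos_of_mem_cylinder hx) x hx y hy
      have h' := ih _ (mem_cylinder_cons.1 hx).2.2 _ (mem_cylinder_cons.1 hy).2.2
      rw [List.length_cons] at h ⊢
      rw [birkhoff_succ, birkhoff_succ, add_sub_add_comm]
      refine (abs_add_le _ _).trans ((add_le_add h h').trans ?_)
      have : C * θ ^ (l.length + 1) ≤ C / (1 - θ) * (θ ^ l.length - θ ^ (l.length + 1)) := by
        rw [div_mul_eq_mul_div, le_div_iff₀ h1', pow_succ]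
        have : 0 ≤ C * θ ^ l.length * (1 - θ) := by positivity
        nlinarith
      linarith
  refine ⟨C / (1 - θ), by positivity, fun l x hx y hy => (key l x hx y hy).trans ?_⟩
  have : 0 ≤ θ ^ l.length := by positivity
  exact mul_le_of_le_one_right (by positivity) (by linarith)

/-- The Birkhoff sums along periodic orbits are almost additive. -/
lemma LocHolder.exists_birkhoff_append {g : ℝ → ℝ} (hg : LocHolder g) :
    ∃ D : ℝ, 0 ≤ D ∧ ∀ l m : List ℕ, (∀ a ∈ l, 0 < a) → (∀ a ∈ m, 0 < a) →
      |birkhoff g (l.length + m.length) (periodicPoint (l ++ m)) -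
        (birkhoff g l.length (periodicPoint l) + birkhoff g m.length (periodicPoint m))| ≤ D := by
  obtain ⟨D, hD, h⟩ := hg.exists_distortion
  have hper : ∀ l : List ℕ, (∀ a ∈ l, 0 < a) → ∀ x ∈ cylinder l,
      |birkhoff g l.length x - birkhoff g l.length (periodicPoint l)| ≤ D := by
    intro l hl x hx
    by_cases hne : l = []
    · simpa [hne, birkhoff] using hD
    · exact h l x hx _ (periodicPoint_mem_cylinder hne hl)
  refine ⟨D + D, by positivity, fun l m hl hm => ?_⟩
  by_cases hne : l ++ m = []
  · obtain ⟨rfl, rfl⟩ := List.append_eq_nil_iff.1 hne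
    simpa [birkhoff] using hD
  · have hlm : ∀ a ∈ l ++ m, 0 < a := fun a ha => (List.mem_append.1 ha).elim (hl a) (hm a)
    obtain ⟨h1, h2⟩ := mem_cylinder_append (periodicPoint_mem_cylinder hne hlm)
    rw [birkhoff_add, add_sub_add_comm]
    exact (abs_add_le _ _).trans (add_le_add (hper l hl _ h1) (hper m hm _ h2))

/-! ### Finiteness of the pressure -/

/-- Splitting a word of length `m + n` after its first `m` letters. -/
def wordAppendEquiv (m n : ℕ) : Word m × Word n ≃ Word (m + n) where
  toFun p := ⟨p.1.1 ++ p.2.1, by simp [p.1.2.1, p.2.2.1],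
    fun a ha => (List.mem_append.1 ha).elim (p.1.2.2 a) (p.2.2.2 a)⟩
  invFun w := (⟨w.1.take m, by simp [w.2.1], fun a ha => w.2.2 a (List.mem_of_mem_take ha)⟩,
    ⟨w.1.drop m, by simp [w.2.1], fun a ha => w.2.2 a (List.mem_of_mem_drop ha)⟩)
  left_inv p := by
    obtain ⟨⟨l, hl, -⟩, ⟨l', hl', -⟩⟩ := p
    subst hl hl'
    simp
  right_inv w := Subtype.ext (List.take_append_drop m w.1)

/-- Words of length one are the positive integers. -/
def wordOneEquiv : ℕ+ ≃ Word 1 where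
  toFun a := ⟨[(a : ℕ)], by simp⟩
  invFun w := ⟨w.1.head (List.ne_nil_of_length_eq_add_one w.2.1), w.2.2 _ (List.head_mem _)⟩
  left_inv a := rfl
  right_inv w := by
    obtain ⟨l, hl, hpos⟩ := w
    obtain ⟨a, rfl⟩ := List.length_eq_one_iff.1 hl
    rfl

lemma partSum_one (g : ℝ → ℝ) :
    partSum g 1 = ∑' a : ℕ+, ENNReal.ofReal (Real.exp (g (periodicPoint [(a : ℕ)]))) := by
  rw [partSum, ← wordOneEquiv.tsum_eq]
  refine tsum_congr fun a => ?_
  rw [birkhoff, Finset.sum_range_one]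
  rfl

lemma partSum_zero (g : ℝ → ℝ) : partSum g 0 = 1 := by
  have : Unique (Word 0) :=
    { default := ⟨[], by simp⟩
      uniq := fun w => Subtype.ext (List.length_eq_zero_iff.1 w.2.1) }
  rw [partSum, tsum_eq_single default fun b hb => (hb (Unique.eq_default b)).elim]
  simp [birkhoff]

lemma tsum_mul_tsum_prod {α β : Type*} (f : α → ℝ≥0∞) (g : β → ℝ≥0∞) :
    (∑' a, f a) * ∑' b, g b = ∑' p : α × β, f p.1 * g p.2 := by
  rw [ENNReal.tsum_prod (f := fun a b => f a * g b), ← ENNReal.tsum_mul_right]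
  exact tsum_congr fun a => ENNReal.tsum_mul_left.symm

lemma partSum_mul (g : ℝ → ℝ) (m n : ℕ) :
    partSum g m * partSum g n = ∑' p : Word m × Word n,
      ENNReal.ofReal (Real.exp (birkhoff g m (periodicPoint p.1.1) +
        birkhoff g n (periodicPoint p.2.1))) := by
  rw [partSum, partSum, tsum_mul_tsum_prod]
  refine tsum_congr fun p => ?_
  rw [Real.exp_add, ENNReal.ofReal_mul (Real.exp_pos _).le]

lemma partSum_pos (g : ℝ → ℝ) (n : ℕ) : partSum g n ≠ 0 := by
  intro h
  have := ENNReal.tsum_eq_zero.1 h ⟨List.replicate n 1, by simp, by simp +contextual⟩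
  exact absurd this (by simp [Real.exp_pos])

lemma LocHolder.exists_partSum_add {g : ℝ → ℝ} (hg : LocHolder g) :
    ∃ D : ℝ, 0 ≤ D ∧ ∀ m n : ℕ,
      partSum g (m + n) ≤ ENNReal.ofReal (Real.exp D) * (partSum g m * partSum g n) ∧
      partSum g m * partSum g n ≤ ENNReal.ofReal (Real.exp D) * partSum g (m + n) := by
  obtain ⟨D, hD, h⟩ := hg.exists_birkhoff_append
  refine ⟨D, hD, fun m n => ?_⟩
  have hw : ∀ p : Word m × Word n, |birkhoff g (m + n) (periodicPoint (wordAppendEquiv m n p).1) -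
      (birkhoff g m (periodicPoint p.1.1) + birkhoff g n (periodicPoint p.2.1))| ≤ D := by
    intro p
    have := h p.1.1 p.2.1 p.1.2.2 p.2.2.2
    rw [p.1.2.1, p.2.2.1] at this
    exact this
  rw [partSum_mul, partSum, ← (wordAppendEquiv m n).tsum_eq, ← ENNReal.tsum_mul_left,
    ← ENNReal.tsum_mul_left]
  constructor
  all_goals
    refine ENNReal.tsum_le_tsum fun p => ?_
    rw [← ENNReal.ofReal_mul (Real.exp_pos _).le, ← Real.exp_add]
    refine ENNReal.ofReal_le_ofReal (Real.exp_le_exp.2 ?_)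
    have := abs_le.1 (hw p)
    linarith

lemma LocHolder.pressureFinite_iff {g : ℝ → ℝ} (hg : LocHolder g) :
    PressureFinite g ↔ partSum g 1 ≠ ⊤ := by
  refine ⟨fun ⟨p, hp, _⟩ => hp 1 one_pos, fun h1 => ?_⟩
  obtain ⟨D, hD, hZ⟩ := hg.exists_partSum_add
  have hfin : ∀ n, partSum g n ≠ ⊤ := by
    intro n
    induction n with
    | zero => simp [partSum_zero]
    | succ n ih =>
      exact ne_top_of_le_ne_top (ENNReal.mul_ne_top ENNReal.ofReal_ne_top
        (ENNReal.mul_ne_top ih h1)) (hZ n 1).1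
  have hpos : ∀ n, 0 < (partSum g n).toReal := fun n =>
    ENNReal.toReal_pos (partSum_pos g n) (hfin n)
  have hlog : ∀ m n, |Real.log (partSum g (m + n)).toReal -
      (Real.log (partSum g m).toReal + Real.log (partSum g n).toReal)| ≤ D := by
    intro m n
    have hup := ENNReal.toReal_mono (ENNReal.mul_ne_top ENNReal.ofReal_ne_top
        (ENNReal.mul_ne_top (hfin m) (hfin n))) (hZ m n).1
    have hlo := ENNReal.toReal_mono (ENNReal.mul_ne_top ENNReal.ofReal_ne_top
        (hfin (m + n))) (hZ m n).2
    simp only [ENNReal.toReal_mul, ENNReal.toReal_ofReal (Real.exp_pos D).le] at hup hlo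
    have hup' := Real.log_le_log (hpos _) hup
    have hlo' := Real.log_le_log (mul_pos (hpos m) (hpos n)) hlo
    rw [Real.log_mul (Real.exp_pos D).ne' (mul_pos (hpos m) (hpos n)).ne', Real.log_exp,
      Real.log_mul (hpos m).ne' (hpos n).ne'] at hup'
    rw [Real.log_mul (Real.exp_pos D).ne' (hpos _).ne', Real.log_exp,
      Real.log_mul (hpos m).ne' (hpos n).ne'] at hlo'
    rw [abs_le]
    constructor <;> linarith
  set L : ℕ → ℝ := fun n => Real.log (partSum g n).toReal with hL
  have hsub : Subadditive fun n => L n + D := by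
    intro m n
    have := abs_le.1 (hlog m n)
    simp only [hL]
    linarith
  have hlin : ∀ n : ℕ, n * (L 1 - D) ≤ L n := by
    intro n
    induction n with
    | zero => simp [hL, partSum_zero]
    | succ n ih =>
      have := abs_le.1 (hlog n 1)
      simp only [hL] at ih ⊢
      push_cast
      linarith
  have hbdd : BddBelow (range fun n : ℕ => (L n + D) / n) := by
    refine ⟨min 0 (L 1 - D), ?_⟩
    rintro _ ⟨n, rfl⟩
    rcases Nat.eq_zero_or_pos n with rfl | hn
    · simp
    · have hn' : (0 : ℝ) < n := by exact_mod_cast hn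
      refine (min_le_right _ _).trans ?_
      rw [le_div_iff₀ hn']
      linarith [hlin n]
  have hlim := (hsub.tendsto_lim hbdd).sub (tendsto_const_div_atTop_nhds_zero_nat D)
  refine ⟨_, fun n _ => hfin n, hlim.congr fun n => ?_⟩
  rw [← sub_div, add_sub_cancel_right]

lemma LocHolder.linearCombination {f g : ℝ → ℝ} (hf : LocHolder f) (hg : LocHolder g) (α β : ℝ) :
    LocHolder fun x => α * f x + β * g x := by
  obtain ⟨C, hC, θ, ⟨h0, h1⟩, hH⟩ := hf
  obtain ⟨C', hC', θ', ⟨h0', h1'⟩, hH'⟩ := hg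
  refine ⟨(|α| + 1) * C + |β| * C', by positivity, max θ θ',
    ⟨lt_max_of_lt_left h0, max_lt h1 h1'⟩, fun l hne hl x hx y hy => ?_⟩
  have hθ : θ ^ l.length ≤ max θ θ' ^ l.length := pow_le_pow_left₀ h0.le (le_max_left _ _) _
  have hθ' : θ' ^ l.length ≤ max θ θ' ^ l.length := pow_le_pow_left₀ h0'.le (le_max_right _ _) _
  calc |α * f x + β * g x - (α * f y + β * g y)|
      = |α * (f x - f y) + β * (g x - g y)| := by ring_nf
    _ ≤ |α| * |f x - f y| + |β| * |g x - g y| := by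
      rw [← abs_mul, ← abs_mul]; exact abs_add_le _ _
    _ ≤ (|α| + 1) * (C * max θ θ' ^ l.length) + |β| * (C' * max θ θ' ^ l.length) := by
      gcongr
      · linarith
      · exact (hH l hne hl x hx y hy).trans (by gcongr)
      · exact (hH' l hne hl x hx y hy).trans (by gcongr)
    _ = _ := by ring

lemma gaussPsi_eq (x : ℝ) : gaussPsi x = 2 * Real.log x := by
  rw [gaussPsi, one_div, Real.log_inv, Real.log_pow]
  push_cast
  ring

lemma locHolder_gaussPsi : LocHolder gaussPsi := by
  refine ⟨8, by norm_num, 1 / 2, by norm_num, fun l hne hl x hx y hy => ?_⟩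
  match l, hne with
  | a :: l, _ =>
    have hl' : ∀ b ∈ l, 0 < b := fun b hb => hl b (List.mem_cons_of_mem _ hb)
    have ha : (1 : ℝ) ≤ a := by exact_mod_cast hl a (by simp)
    obtain ⟨u, hu, rfl⟩ := exists_eq_invBranch hx
    obtain ⟨v, hv, rfl⟩ := exists_eq_invBranch hy
    have h := abs_invBranch_sub_le l hl' hu.1 hv.1
    have huv : |u - v| ≤ 1 := by
      rw [abs_le]
      constructor <;> linarith [hu.1.1, hu.1.2, hv.1.1, hv.1.2]
    have hp : ∀ w z : ℝ, 0 ≤ w → 0 ≤ z →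
        Real.log (w + a) - Real.log (z + a) ≤ |w - z| := by
      intro w z hw hz
      have h1 := Real.log_le_sub_one_of_pos (show 0 < (w + a) / (z + a) by positivity)
      rw [Real.log_div (by positivity) (by positivity)] at h1
      refine h1.trans ?_
      rw [div_sub_one (by positivity), div_le_iff₀ (by positivity)]
      nlinarith [le_abs_self (w - z), abs_nonneg (w - z)]
    have hu0 := (invBranch_mem_Icc hl' hu.1).1
    have hv0 := (invBranch_mem_Icc hl' hv.1).1
    change |gaussPsi (invBranch l u + a)⁻¹ - gaussPsi (invBranch l v + a)⁻¹| ≤ _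
    rw [gaussPsi_eq, gaussPsi_eq, Real.log_inv, Real.log_inv, List.length_cons, pow_succ, abs_le]
    have h1 := hp _ _ hu0 hv0
    have h2 := hp _ _ hv0 hu0
    rw [abs_sub_comm] at h2
    have h3 : 2 * (1 / 2 : ℝ) ^ l.length * |u - v| ≤ 2 * (1 / 2) ^ l.length :=
      mul_le_of_le_one_right (by positivity) huv
    constructor <;> linarith

/-! ### Digit moments -/

lemma measurableSet_gaussSet : MeasurableSet gaussSet :=
  measurableSet_Icc.inter (countable_range ((↑) : ℚ → ℝ)).measurableSet.compl

lemma measurable_cfDigit1 : Measurable cfDigit1 := Nat.measurable_floor.comp measurable_inv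

lemma mem_cylinder_singleton {a : ℕ} {x : ℝ} :
    x ∈ cylinder [a] ↔ x ∈ gaussSet ∧ cfDigit1 x = a := by
  rw [mem_cylinder_cons, mem_cylinder_nil]
  exact ⟨fun h => ⟨h.1, h.2.1⟩, fun h => ⟨h.1, h.2, gaussMap_mem h.1⟩⟩

lemma measurableSet_cylinder_singleton (a : ℕ) : MeasurableSet (cylinder [a]) := by
  have : cylinder [a] = gaussSet ∩ cfDigit1 ⁻¹' {a} := ext fun x => mem_cylinder_singleton
  rw [this]
  exact measurableSet_gaussSet.inter (measurable_cfDigit1 (measurableSet_singleton a))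

lemma measure_digit_ge (μ : Measure ℝ) (n : ℕ) :
    μ {x | x ∈ gaussSet ∧ n ≤ cfDigit1 x} =
      ∑' a : ℕ+, if n ≤ (a : ℕ) then μ (cylinder [(a : ℕ)]) else 0 := by
  have hset : {x | x ∈ gaussSet ∧ n ≤ cfDigit1 x} =
      ⋃ a : ℕ+, if n ≤ (a : ℕ) then cylinder [(a : ℕ)] else ∅ := by
    ext x
    simp only [mem_ofPred_eq, mem_iUnion]
    constructor
    · rintro ⟨hx, hn⟩
      refine ⟨⟨cfDigit1 x, cfDigit1_pos hx⟩, ?_⟩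
      rw [PNat.mk_coe, if_pos hn]
      exact mem_cylinder_singleton.2 ⟨hx, rfl⟩
    · rintro ⟨a, ha⟩
      split_ifs at ha with hn
      · obtain ⟨hx, hxa⟩ := mem_cylinder_singleton.1 ha
        exact ⟨hx, hxa ▸ hn⟩
      · exact ha.elim
  rw [hset, measure_iUnion]
  · refine tsum_congr fun a => ?_
    split_ifs
    · rfl
    · exact measure_empty
  · intro a b hab
    refine Set.disjoint_left.2 fun x hxa hxb => hab ?_
    beta_reduce at hxa hxb
    split_ifs at hxa hxb
    · exact PNat.eq ((mem_cylinder_singleton.1 hxa).2.symm.trans (mem_cylinder_singleton.1 hxb).2)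
    all_goals simp at hxa hxb
  · intro a
    split_ifs
    · exact measurableSet_cylinder_singleton _
    · exact MeasurableSet.empty

lemma tsum_ofReal_mul_rpow_ne_top (K : ℝ) {p : ℝ} (hp : p < -1) :
    ∑' n : ℕ+, ENNReal.ofReal (K * (n : ℝ) ^ p) ≠ ⊤ := by
  have h : Summable fun n : ℕ+ => K * ((n : ℕ) : ℝ) ^ p :=
    ((Real.summable_nat_rpow.2 hp).comp_injective PNat.coe_injective).mul_left K
  exact h.tsum_ofReal_ne_top

lemma ofReal_rpow_le_tsum {ε : ℝ} (hε : ε ≤ 1) (a : ℕ+) :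
    ENNReal.ofReal ((a : ℝ) ^ ε) ≤
      ∑' n : ℕ+, if (n : ℕ) ≤ a then ENNReal.ofReal ((n : ℝ) ^ (ε - 1)) else 0 := by
  have ha : (0 : ℝ) < a := by exact_mod_cast a.pos
  refine le_trans ?_ (ENNReal.sum_le_tsum (Finset.Icc 1 a))
  have hcard := Finset.card_nsmul_le_sum (Finset.Icc 1 a)
    (fun n : ℕ+ => if (n : ℕ) ≤ a then ENNReal.ofReal ((n : ℝ) ^ (ε - 1)) else 0)
    (ENNReal.ofReal ((a : ℝ) ^ (ε - 1))) (fun n hn => ?_)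
  · refine le_trans (le_of_eq ?_) hcard
    rw [PNat.card_Icc, nsmul_eq_mul, ← ENNReal.ofReal_natCast,
      ← ENNReal.ofReal_mul (Nat.cast_nonneg _), Real.rpow_sub_one ha.ne']
    congr 1
    simp only [PNat.one_coe, Nat.add_sub_cancel]
    field_simp
  · have hna : (n : ℕ) ≤ a := (Finset.mem_Icc.1 hn).2
    have hn0 : (0 : ℝ) < n := by exact_mod_cast n.pos
    rw [if_pos hna]
    exact ENNReal.ofReal_le_ofReal
      (Real.rpow_le_rpow_of_nonpos hn0 (by exact_mod_cast hna) (by linarith))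

lemma tsum_digit_moment_ne_top {μ : Measure ℝ} [IsFiniteMeasure μ] {δ K ε : ℝ}
    (hK : ∀ n : ℕ, 0 < n →
      (μ {x | x ∈ gaussSet ∧ n ≤ cfDigit1 x}).toReal ≤ K * (n : ℝ) ^ (-δ))
    (hε1 : ε ≤ 1) (hεδ : ε < δ) :
    ∑' a : ℕ+, μ (cylinder [(a : ℕ)]) * ENNReal.ofReal ((a : ℝ) ^ ε) ≠ ⊤ := by
  refine ne_top_of_le_ne_top (tsum_ofReal_mul_rpow_ne_top K (p := ε - 1 - δ) (by linarith)) ?_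
  calc ∑' a : ℕ+, μ (cylinder [(a : ℕ)]) * ENNReal.ofReal ((a : ℝ) ^ ε)
      ≤ ∑' a : ℕ+, ∑' n : ℕ+, μ (cylinder [(a : ℕ)]) *
          (if (n : ℕ) ≤ a then ENNReal.ofReal ((n : ℝ) ^ (ε - 1)) else 0) := by
        refine ENNReal.tsum_le_tsum fun a => ?_
        rw [ENNReal.tsum_mul_left]
        gcongr
        exact ofReal_rpow_le_tsum hε1 a
    _ = ∑' n : ℕ+, ∑' a : ℕ+, ENNReal.ofReal ((n : ℝ) ^ (ε - 1)) *
          (if (n : ℕ) ≤ a then μ (cylinder [(a : ℕ)]) else 0) := by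
        rw [ENNReal.tsum_comm]
        refine tsum_congr fun n => tsum_congr fun a => ?_
        split_ifs
        · exact mul_comm _ _
        · simp
    _ ≤ ∑' n : ℕ+, ENNReal.ofReal (K * (n : ℝ) ^ (ε - 1 - δ)) := by
        refine ENNReal.tsum_le_tsum fun n => ?_
        have hn : (0 : ℝ) < n := by exact_mod_cast n.pos
        rw [ENNReal.tsum_mul_left, ← measure_digit_ge,
          ← ENNReal.ofReal_toReal (measure_ne_top μ {x | x ∈ gaussSet ∧ (n : ℕ) ≤ cfDigit1 x}),
          ← ENNReal.ofReal_mul (by positivity)]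
        refine ENNReal.ofReal_le_ofReal ?_
        calc _ ≤ (n : ℝ) ^ (ε - 1) * (K * (n : ℝ) ^ (-δ)) := by
              gcongr
              exact hK n n.pos
          _ = _ := by rw [sub_eq_add_neg _ δ, Real.rpow_add hn]; ring

lemma log_periodicPoint_singleton (a : ℕ+) :
    -Real.log a - Real.log 2 ≤ Real.log (periodicPoint [(a : ℕ)]) ∧
      Real.log (periodicPoint [(a : ℕ)]) ≤ -Real.log a := by
  have hpos : ∀ b ∈ [(a : ℕ)], 0 < b := by simp
  have ha : (1 : ℝ) ≤ a := by exact_mod_cast a.pos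
  have hfix := invBranch_periodicPoint (List.cons_ne_nil _ _) hpos
  obtain ⟨h0, h1⟩ := periodicPoint_mem_Icc (List.cons_ne_nil _ _) hpos
  rw [← hfix]
  set r := periodicPoint [(a : ℕ)]
  change _ ≤ Real.log (r + a)⁻¹ ∧ Real.log (r + a)⁻¹ ≤ _
  rw [Real.log_inv]
  constructor
  · have : Real.log (r + a) ≤ Real.log (a * 2) := Real.log_le_log (by linarith) (by linarith)
    rw [Real.log_mul (by positivity) (by norm_num)] at this
    linarith
  · have : Real.log a ≤ Real.log (r + a) := Real.log_le_log (by linarith) (by linarith)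
    linarith

lemma IsGibbs.exists_singleton {φ : ℝ → ℝ} {μ : Measure ℝ} (h : IsGibbs φ μ) :
    ∃ C : ℝ, 1 ≤ C ∧ ∀ a : ℕ+,
      Real.exp (φ (periodicPoint [(a : ℕ)])) ≤ C * (μ (cylinder [(a : ℕ)])).toReal ∧
      (μ (cylinder [(a : ℕ)])).toReal ≤ C * Real.exp (φ (periodicPoint [(a : ℕ)])) := by
  obtain ⟨C, hC, hG⟩ := h
  refine ⟨C, hC, fun a => ?_⟩
  have hpos : ∀ b ∈ [(a : ℕ)], 0 < b := by simp
  obtain ⟨h1, h2⟩ := hG [(a : ℕ)] (by simp) hpos _ (periodicPoint_mem_gaussSet (by simp) hpos)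
  rw [invBranch_periodicPoint (by simp) hpos, List.length_singleton, birkhoff,
    Finset.sum_range_one] at h1 h2
  rw [inv_mul_le_iff₀ (by linarith)] at h1
  exact ⟨h1, h2⟩

lemma exp_linearCombination_le {p a L ε α β : ℝ} (hp : p ≤ 0) (ha : 1 ≤ a) (hε0 : 0 ≤ ε)
    (hε1 : ε ≤ 1) (hL : -Real.log a - Real.log 2 ≤ L) (hL' : L ≤ -Real.log a)
    (hα : 1 - ε / 8 ≤ α) (hβ : |β| ≤ ε / 4) :
    Real.exp (α * p + β * (2 * L)) ≤ 2 * (Real.exp p * a ^ ε + a ^ (-2 : ℝ)) := by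
  have ha0 : 0 < a := by linarith
  have hl := Real.log_nonneg ha
  have hl2 := Real.log_pos one_lt_two
  rw [Real.rpow_def_of_pos ha0, Real.rpow_def_of_pos ha0, ← Real.exp_add]
  have hβL : β * (2 * L) ≤ ε / 2 * Real.log a + Real.log 2 := by
    calc β * (2 * L) ≤ |β| * |2 * L| := by rw [← abs_mul]; exact le_abs_self _
      _ ≤ ε / 4 * (2 * (Real.log a + Real.log 2)) := by
        gcongr
        rw [abs_le]
        constructor <;> linarith
      _ ≤ _ := by nlinarith
  have hαp : α * p ≤ (1 - ε / 8) * p := mul_le_mul_of_nonpos_right hα hp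
  have key : Real.exp ((1 - ε / 8) * p + ε / 2 * Real.log a) ≤
      Real.exp (p + Real.log a * ε) + Real.exp (Real.log a * (-2)) := by
    rcases le_total (-4 * Real.log a) p with h | h
    · refine le_add_of_le_of_nonneg (Real.exp_le_exp.2 ?_) (Real.exp_pos _).le
      nlinarith
    · refine le_add_of_nonneg_of_le (Real.exp_pos _).le (Real.exp_le_exp.2 ?_)
      nlinarith
  calc Real.exp (α * p + β * (2 * L))
      ≤ Real.exp (Real.log 2 + ((1 - ε / 8) * p + ε / 2 * Real.log a)) :=
        Real.exp_le_exp.2 (by linarith)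
    _ ≤ _ := by
      rw [Real.exp_add, Real.exp_log two_pos]
      gcongr

lemma partSum_one_ne_top_of_moment {φ : ℝ → ℝ} {μ : Measure ℝ} [IsFiniteMeasure μ]
    (hφ0 : ∀ x ∈ gaussSet, φ x ≤ 0) (hGibbs : IsGibbs φ μ) {ε α β : ℝ} (hε0 : 0 ≤ ε) (hε1 : ε ≤ 1)
    (hm : ∑' a : ℕ+, μ (cylinder [(a : ℕ)]) * ENNReal.ofReal ((a : ℝ) ^ ε) ≠ ⊤)
    (hα : 1 - ε / 8 ≤ α) (hβ : |β| ≤ ε / 4) :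
    partSum (fun x => α * φ x + β * gaussPsi x) 1 ≠ ⊤ := by
  obtain ⟨C, hC, hG⟩ := hGibbs.exists_singleton
  have hsum : ∑' a : ℕ+, (ENNReal.ofReal (2 * C) *
      (μ (cylinder [(a : ℕ)]) * ENNReal.ofReal ((a : ℝ) ^ ε)) +
        ENNReal.ofReal (2 * (a : ℝ) ^ (-2 : ℝ))) ≠ ⊤ := by
    rw [ENNReal.tsum_add, ENNReal.tsum_mul_left]
    exact ENNReal.add_ne_top.2 ⟨ENNReal.mul_ne_top ENNReal.ofReal_ne_top hm,
      tsum_ofReal_mul_rpow_ne_top 2 (by norm_num)⟩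
  rw [partSum_one]
  refine ne_top_of_le_ne_top hsum (ENNReal.tsum_le_tsum fun a => ?_)
  have ha : (1 : ℝ) ≤ a := by exact_mod_cast a.pos
  obtain ⟨hL, hL'⟩ := log_periodicPoint_singleton a
  have hp := hφ0 _ (periodicPoint_mem_gaussSet (l := [(a : ℕ)]) (by simp) (by simp))
  rw [gaussPsi_eq, ← ENNReal.ofReal_toReal (measure_ne_top μ (cylinder [(a : ℕ)])),
    ← ENNReal.ofReal_mul ENNReal.toReal_nonneg, ← ENNReal.ofReal_mul (by positivity),
    ← ENNReal.ofReal_add (by positivity) (by positivity)]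
  refine ENNReal.ofReal_le_ofReal
    ((exp_linearCombination_le hp ha hε0 hε1 hL hL' hα hβ).trans ?_)
  have := mul_le_mul_of_nonneg_right (hG a).1 (show 0 ≤ (a : ℝ) ^ ε by positivity)
  linarith

lemma exists_tail_bound_of_partSum_one {φ : ℝ → ℝ} {μ : Measure ℝ} [IsFiniteMeasure μ]
    (hGibbs : IsGibbs φ μ) {τ : ℝ} (hτ : 0 ≤ τ)
    (hZ : partSum (fun x => -τ * gaussPsi x + φ x) 1 ≠ ⊤) :
    ∃ K : ℝ, ∀ n : ℕ, 0 < n →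
      (μ {x | x ∈ gaussSet ∧ n ≤ cfDigit1 x}).toReal ≤ K * (n : ℝ) ^ (-(2 * τ)) := by
  obtain ⟨C, hC, hG⟩ := hGibbs.exists_singleton
  refine ⟨C * (partSum (fun x => -τ * gaussPsi x + φ x) 1).toReal, fun n hn => ?_⟩
  have hn0 : (0 : ℝ) < n := by exact_mod_cast hn
  have hle : μ {x | x ∈ gaussSet ∧ n ≤ cfDigit1 x} ≤
      ENNReal.ofReal (C * (n : ℝ) ^ (-(2 * τ))) *
        partSum (fun x => -τ * gaussPsi x + φ x) 1 := by
    rw [measure_digit_ge, partSum_one, ← ENNReal.tsum_mul_left]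
    refine ENNReal.tsum_le_tsum fun a => ?_
    split_ifs with hna
    · rw [← ENNReal.ofReal_mul (by positivity),
        ← ENNReal.ofReal_toReal (measure_ne_top μ (cylinder [(a : ℕ)]))]
      refine ENNReal.ofReal_le_ofReal ((hG a).2.trans ?_)
      rw [mul_assoc, Real.rpow_def_of_pos hn0, ← Real.exp_add, gaussPsi_eq]
      have hlog : Real.log n ≤ Real.log a := Real.log_le_log hn0 (by exact_mod_cast hna)
      have hL' := (log_periodicPoint_singleton a).2
      gcongr
      nlinarith
    · exact bot_le
  have := ENNReal.toReal_mono (ENNReal.mul_ne_top ENNReal.ofReal_ne_top hZ) hle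
  rw [ENNReal.toReal_mul, ENNReal.toReal_ofReal (by positivity)] at this
  linarith

/-- The polynomial tail condition for `μ_φ` is equivalent to the
finiteness of the pressures `P(tψ+φ)` and `P(t(φ-sψ)+φ)` for `t` in a neighbourhood
of the origin, where `s = h_{μ_φ}/λ_{μ_φ}`. -/
theorem tail_iff_pressure_finite
    (φ : ℝ → ℝ) (μ : MeasureTheory.Measure ℝ) [MeasureTheory.IsProbabilityMeasure μ]
    (hμX : μ gaussSet = 1) (hinv : GaussInvariant μ)
    (hφH : LocHolder φ) (hφ0 : ∀ x ∈ gaussSet, φ x ≤ 0) (hP : HasPressure φ 0)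
    (hL : TransferNormalized φ) (hGibbs : IsGibbs φ μ)
    (h s : ℝ) (hent : HasEntropy μ h) (hs : s = h / lyapunov μ) :
    (∃ δ > (0:ℝ), ∃ K : ℝ, ∀ n : ℕ, 0 < n →
        (μ {x | x ∈ gaussSet ∧ n ≤ cfDigit1 x}).toReal ≤ K * (n : ℝ) ^ (-δ)) ↔
    (∃ t₀ > (0:ℝ), ∀ t : ℝ, -t₀ < t → t < t₀ →
        PressureFinite (fun x => t * gaussPsi x + φ x) ∧
        PressureFinite fun x => t * (φ x - s * gaussPsi x) + φ x) := by
  have hlc := hφH.linearCombination locHolder_gaussPsi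
  constructor
  · rintro ⟨δ, hδ, K, hK⟩
    set ε : ℝ := min δ 1 / 2 with hε
    have hε0 : 0 < ε := by positivity
    have hεδ : ε < δ := by rw [hε]; linarith [min_le_left δ 1]
    have hε1 : ε ≤ 1 := by rw [hε]; linarith [min_le_right δ 1]
    have hm := tsum_digit_moment_ne_top hK hε1 hεδ
    have hfin : ∀ α β : ℝ, 1 - ε / 8 ≤ α → |β| ≤ ε / 4 →
        PressureFinite fun x => α * φ x + β * gaussPsi x := fun α β hα hβ =>
      (hlc α β).pressureFinite_iff.2
        (partSum_one_ne_top_of_moment hφ0 hGibbs hε0.le hε1 hm hα hβ)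
    refine ⟨ε / 8 / (1 + |s|), by positivity, fun t ht ht' => ?_⟩
    have habs : |t| * (1 + |s|) < ε / 8 := (lt_div_iff₀ (by positivity)).1 (abs_lt.2 ⟨ht, ht'⟩)
    have hts : 0 ≤ |t| * |s| := by positivity
    have ht0 := neg_abs_le t
    constructor
    · convert hfin 1 t (by linarith) (by linarith) using 2 with x
      ring
    · convert hfin (1 + t) (-(t * s)) (by linarith [abs_nonneg t])
        (by rw [abs_neg, abs_mul]; linarith [abs_nonneg t]) using 2 with x
      ring
  · rintro ⟨t₀, ht₀, ht⟩
    have hZ := (ht (-(t₀ / 2)) (by linarith) (by linarith)).1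
    obtain ⟨p, hp, -⟩ := hZ
    obtain ⟨K, hK⟩ := exists_tail_bound_of_partSum_one hGibbs (by positivity) (hp 1 one_pos)
    exact ⟨2 * (t₀ / 2), by positivity, K, hK⟩
end

section
/- Let ψ : [0,1] → ℝ be a C² map whose derivative has the form ψ′(x) = φ(x)·(α₁x + α₂) for some C¹ map φ : [0,1] → ℝ satisfying a ≤ |φ(x)| ≤ b and |φ′(x)| ≤ b for all x ∈ [0,1], where b > a > 0. If α₁ ≠ 0, then |∫₀¹ e^{2πiψ(x)} dx| ≤ 6 b a^{−3/2} |α₁|^{−1/2}. -/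
open MeasureTheory Filter Set Topology
open scoped ENNReal NNReal Classical Real

/-- First derivative test: an oscillatory integral without stationary points is controlled by
the reciprocal of the phase derivative and the variation of that reciprocal. -/
lemma norm_integral_exp_le_of_deriv_ne_zero {ψ d dd g : ℝ → ℝ} {p q B : ℝ} (hpq : p ≤ q)
    (hψc : ContinuousOn ψ (Icc p q)) (hdc : ContinuousOn d (Icc p q))
    (hddc : ContinuousOn dd (Icc p q)) (hgc : ContinuousOn g (Icc p q))
    (hψ : ∀ x ∈ Ioo p q, HasDerivAt ψ (d x) x) (hd : ∀ x ∈ Ioo p q, HasDerivAt d (dd x) x)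
    (hd0 : ∀ x ∈ Icc p q, d x ≠ 0) (hB : ∀ x ∈ Icc p q, |d x|⁻¹ ≤ B)
    (hg : ∀ x ∈ Icc p q, |dd x| / (d x) ^ 2 ≤ g x) :
    ‖∫ x in p..q, Complex.exp ((2 * Real.pi * ψ x : ℝ) * Complex.I)‖ ≤
      (2 * Real.pi)⁻¹ * (2 * B + ∫ x in p..q, g x) := by
  have hπc : (2 * Real.pi * Complex.I : ℂ) ≠ 0 := by
    simp [Real.pi_ne_zero]
  set e : ℝ → ℂ := fun x => Complex.exp ((2 * Real.pi * ψ x : ℝ) * Complex.I) with he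
  have hnorm : ∀ x, ‖e x‖ = 1 := fun x => Complex.norm_exp_ofReal_mul_I _
  have hec : ContinuousOn e (Icc p q) := by
    simp only [he]
    fun_prop
  set F : ℝ → ℂ := fun x => e x * (2 * Real.pi * Complex.I * (d x : ℂ))⁻¹ with hF
  set G : ℝ → ℂ := fun x => e x * ((dd x : ℂ) / (2 * Real.pi * Complex.I * (d x : ℂ) ^ 2)) with hG
  have hden : ∀ x ∈ Icc p q, (2 * Real.pi * Complex.I * (d x : ℂ)) ≠ 0 := fun x hx =>
    mul_ne_zero hπc (Complex.ofReal_ne_zero.2 (hd0 x hx))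
  have hdcC : ContinuousOn (fun x => (d x : ℂ)) (Icc p q) :=
    Complex.continuous_ofReal.comp_continuousOn hdc
  have hddcC : ContinuousOn (fun x => (dd x : ℂ)) (Icc p q) :=
    Complex.continuous_ofReal.comp_continuousOn hddc
  have hFc : ContinuousOn F (Icc p q) :=
    hec.mul ((continuousOn_const.mul hdcC).inv₀ hden)
  have hGc : ContinuousOn G (Icc p q) :=
    hec.mul (hddcC.div (continuousOn_const.mul (hdcC.pow 2)) fun x hx =>
      mul_ne_zero hπc (pow_ne_zero 2 (Complex.ofReal_ne_zero.2 (hd0 x hx))))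
  have hFd : ∀ x ∈ Ioo p q, HasDerivAt F (e x - G x) x := by
    intro x hx
    have hx' := Ioo_subset_Icc_self hx
    have h1 : HasDerivAt e (e x * ((2 * Real.pi * d x : ℝ) * Complex.I)) x :=
      ((((hψ x hx).const_mul (2 * Real.pi)).ofReal_comp).mul_const Complex.I).cexp
    have h2 := (((hd x hx).ofReal_comp).const_mul (2 * Real.pi * Complex.I : ℂ)).inv (hden x hx')
    have hdx : (d x : ℂ) ≠ 0 := Complex.ofReal_ne_zero.2 (hd0 x hx')
    have hpi : (Real.pi : ℂ) ≠ 0 := Complex.ofReal_ne_zero.2 Real.pi_ne_zero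
    refine (h1.mul h2).congr_deriv ?_
    simp only [hG, Pi.inv_apply]
    push_cast
    field_simp
    ring
  have hei : IntervalIntegrable e volume p q := hec.intervalIntegrable_of_Icc hpq
  have hGi : IntervalIntegrable G volume p q := hGc.intervalIntegrable_of_Icc hpq
  have hftc := intervalIntegral.integral_eq_sub_of_hasDerivAt_of_le hpq hFc hFd (hei.sub hGi)
  rw [intervalIntegral.integral_sub hei hGi] at hftc
  have heq : ∫ x in p..q, e x = F q - F p + ∫ x in p..q, G x := by
    rw [← hftc]; ring
  have hFB : ∀ x ∈ Icc p q, ‖F x‖ ≤ (2 * Real.pi)⁻¹ * B := by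
    intro x hx
    have : ‖F x‖ = (2 * Real.pi)⁻¹ * |d x|⁻¹ := by
      simp only [hF, norm_mul, hnorm, norm_inv, Complex.norm_I, Complex.norm_real,
        Real.norm_eq_abs, abs_of_pos Real.pi_pos, Complex.norm_ofNat, mul_inv]
      ring
    rw [this]
    exact mul_le_mul_of_nonneg_left (hB x hx) (by positivity)
  have hGB : ‖∫ x in p..q, G x‖ ≤ ∫ x in p..q, (2 * Real.pi)⁻¹ * g x := by
    refine intervalIntegral.norm_integral_le_of_norm_le hpq ?_
      ((continuousOn_const.mul hgc).intervalIntegrable_of_Icc hpq)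
    refine Eventually.of_forall fun x hx => ?_
    have hx' := Ioc_subset_Icc_self hx
    have : ‖G x‖ = (2 * Real.pi)⁻¹ * (|dd x| / (d x) ^ 2) := by
      simp only [hG, norm_mul, hnorm, norm_div, norm_pow, Complex.norm_I, Complex.norm_real,
        Real.norm_eq_abs, abs_of_pos Real.pi_pos, Complex.norm_ofNat, sq_abs]
      field_simp
    rw [this]
    exact mul_le_mul_of_nonneg_left (hg x hx') (by positivity)
  rw [intervalIntegral.integral_const_mul] at hGB
  have := hFB p (left_mem_Icc.2 hpq)
  have := hFB q (right_mem_Icc.2 hpq)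
  rw [heq]
  linarith [norm_add_le (F q - F p) (∫ x in p..q, G x), norm_sub_le (F q) (F p)]

/-- The function `(x - c)⁻²` has integral at most `2 / δ` over any interval at distance at
least `δ` from `c`. -/
lemma integral_inv_sub_sq_le {p q c δ : ℝ} (hpq : p ≤ q) (hδ : 0 < δ)
    (hc : ∀ x ∈ Icc p q, δ ≤ |x - c|) :
    ∫ x in p..q, ((x - c) ^ 2)⁻¹ ≤ 2 / δ := by
  have h0 : ∀ x ∈ Icc p q, x - c ≠ 0 := fun x hx => abs_pos.1 (hδ.trans_le (hc x hx))
  have hcont : ContinuousOn (fun x : ℝ => ((x - c) ^ 2)⁻¹) (Icc p q) :=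
    ContinuousOn.inv₀ (by fun_prop) fun x hx => pow_ne_zero 2 (h0 x hx)
  have hF : ∀ x ∈ uIcc p q, HasDerivAt (fun x : ℝ => -(x - c)⁻¹) (((x - c) ^ 2)⁻¹) x := by
    intro x hx
    rw [uIcc_of_le hpq] at hx
    refine ((((hasDerivAt_id x).sub_const c).inv (h0 x hx)).neg).congr_deriv ?_
    simp [neg_div]
  rw [intervalIntegral.integral_eq_sub_of_hasDerivAt hF (hcont.intervalIntegrable_of_Icc hpq)]
  have hb : ∀ x ∈ Icc p q, |(x - c)⁻¹| ≤ 1 / δ := by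
    intro x hx
    rw [abs_inv, one_div]
    exact inv_anti₀ hδ (hc x hx)
  have h1 := abs_le.1 (hb p (left_mem_Icc.2 hpq))
  have h2 := abs_le.1 (hb q (right_mem_Icc.2 hpq))
  have h3 : 2 / δ = 1 / δ + 1 / δ := by ring
  linarith

/-- Away from the stationary point `c`, the phase with derivative `φ x * (α * (x - c))`
contributes at most `2 * (b * δ / a)`, where `δ = (a |α|)^(-1/2)`. -/
lemma norm_integral_exp_le_of_le_dist_stationary {ψ φ φd : ℝ → ℝ} {α c a b δ p q : ℝ}
    (ha : 0 < a) (hab : a < b) (hδ : 0 < δ) (hδα : δ ^ 2 * a * |α| = 1)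
    (hp : 0 ≤ p) (hpq : p ≤ q) (hq : q ≤ 1)
    (hψ : ∀ x ∈ Icc (0:ℝ) 1, HasDerivWithinAt ψ (φ x * (α * (x - c))) (Icc 0 1) x)
    (hφd : ∀ x ∈ Icc (0:ℝ) 1, HasDerivWithinAt φ (φd x) (Icc 0 1) x)
    (hφdc : ContinuousOn φd (Icc 0 1))
    (hφa : ∀ x ∈ Icc (0:ℝ) 1, a ≤ |φ x|)
    (hφdb : ∀ x ∈ Icc (0:ℝ) 1, |φd x| ≤ b)
    (hc : ∀ x ∈ Icc p q, δ ≤ |x - c|) :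
    ‖∫ x in p..q, Complex.exp ((2 * Real.pi * ψ x : ℝ) * Complex.I)‖ ≤ 2 * (b * δ / a) := by
  have hsub : Icc p q ⊆ Icc (0:ℝ) 1 := Icc_subset_Icc hp hq
  have hnhds : ∀ x ∈ Ioo p q, Icc (0:ℝ) 1 ∈ 𝓝 x := fun x hx =>
    Icc_mem_nhds (hp.trans_lt hx.1) (hx.2.trans_le hq)
  have hα : 0 < |α| := by
    rcases (abs_nonneg α).eq_or_lt with h | h
    · rw [← h] at hδα; simp at hδα
    · exact h
  have hb : 0 < b := ha.trans hab
  have hφc : ContinuousOn φ (Icc p q) := fun x hx =>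
    ((hφd x (hsub hx)).continuousWithinAt).mono hsub
  have hx0 : ∀ x ∈ Icc p q, x - c ≠ 0 := fun x hx => abs_pos.1 (hδ.trans_le (hc x hx))
  have hφ0 : ∀ x ∈ Icc p q, 0 < |φ x| := fun x hx => ha.trans_le (hφa x (hsub hx))
  have hgc : ContinuousOn (fun x : ℝ => ((x - c) ^ 2)⁻¹) (Icc p q) :=
    ContinuousOn.inv₀ (by fun_prop) fun x hx => pow_ne_zero 2 (hx0 x hx)
  have hφdc' := hφdc.mono hsub
  have main := norm_integral_exp_le_of_deriv_ne_zero (ψ := ψ)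
    (d := fun x => φ x * (α * (x - c)))
    (dd := fun x => φd x * (α * (x - c)) + φ x * α)
    (g := fun x => b * δ / a + δ ^ 2 * ((x - c) ^ 2)⁻¹) (p := p) (q := q) (B := δ) hpq
    (fun x hx => ((hψ x (hsub hx)).continuousWithinAt).mono hsub)
    (by fun_prop) (by fun_prop) (by fun_prop)
    (fun x hx => (hψ x (hsub (Ioo_subset_Icc_self hx))).hasDerivAt (hnhds x hx))
    (fun x hx => by
      have h1 := (hφd x (hsub (Ioo_subset_Icc_self hx))).hasDerivAt (hnhds x hx)
      have h2 := ((hasDerivAt_id x).sub_const c).const_mul α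
      exact (h1.mul h2).congr_deriv (by simp))
    (fun x hx => mul_ne_zero (abs_pos.1 (hφ0 x hx)) (mul_ne_zero (abs_pos.1 hα) (hx0 x hx)))
    (fun x hx => by
      rw [abs_mul, abs_mul]
      have h1 : a * (|α| * δ) ≤ |φ x| * (|α| * |x - c|) := by
        gcongr
        · exact hφa x (hsub hx)
        · exact hc x hx
      have h2 : (a * (|α| * δ))⁻¹ = δ := by
        refine inv_eq_of_mul_eq_one_right ?_
        linarith
      calc _ ≤ (a * (|α| * δ))⁻¹ := inv_anti₀ (by positivity) h1
        _ = δ := h2)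
    (fun x hx => by
      have hu : 0 < |x - c| := hδ.trans_le (hc x hx)
      have hf := hφ0 x hx
      have hfa := hφa x (hsub hx)
      have hE : |φd x * (α * (x - c)) + φ x * α| ≤ b * (|α| * |x - c|) + |φ x| * |α| := by
        refine (abs_add_le _ _).trans ?_
        rw [abs_mul, abs_mul, abs_mul]
        gcongr
        exact hφdb x (hsub hx)
      have hsq : (φ x * (α * (x - c))) ^ 2 = (|φ x| * (|α| * |x - c|)) ^ 2 := by
        rw [← abs_mul, ← abs_mul, sq_abs]
      have hsq' : (x - c) ^ 2 = |x - c| ^ 2 := (sq_abs _).symm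
      rw [hsq, hsq']
      calc _ ≤ (b * (|α| * |x - c|) + |φ x| * |α|) / (|φ x| * (|α| * |x - c|)) ^ 2 := by gcongr
        _ = b / (|φ x| ^ 2 * (|α| * |x - c|)) + 1 / (|φ x| * |α| * |x - c| ^ 2) := by
          field_simp
        _ ≤ b / (a ^ 2 * (|α| * δ)) + 1 / (a * |α| * |x - c| ^ 2) := by
          gcongr
          exact hc x hx
        _ = b * δ / a * (δ ^ 2 * a * |α|)⁻¹ + δ ^ 2 * (|x - c| ^ 2)⁻¹ * (δ ^ 2 * a * |α|)⁻¹ := by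
          field_simp
        _ = _ := by rw [hδα]; ring)
  refine main.trans ?_
  have hgi : IntervalIntegrable (fun x : ℝ => ((x - c) ^ 2)⁻¹) volume p q :=
    hgc.intervalIntegrable_of_Icc hpq
  rw [intervalIntegral.integral_add (by simp) (hgi.const_mul _),
    intervalIntegral.integral_const_mul, intervalIntegral.integral_const, smul_eq_mul]
  have h1 : δ ^ 2 * ∫ x in p..q, ((x - c) ^ 2)⁻¹ ≤ 2 * δ := by
    calc _ ≤ δ ^ 2 * (2 / δ) :=
          mul_le_mul_of_nonneg_left (integral_inv_sub_sq_le hpq hδ hc) (by positivity)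
      _ = 2 * δ := by field_simp
  have hK : 0 < b * δ / a := by positivity
  have hδK : δ ≤ b * δ / a := by
    rw [le_div_iff₀ ha]; nlinarith
  have h2 : (q - p) * (b * δ / a) ≤ b * δ / a := mul_le_of_le_one_left hK.le (by linarith)
  rw [inv_mul_le_iff₀ (by positivity)]
  nlinarith [Real.pi_gt_three]

/-- Stationary phase, first form: if `ψ' = φ·(α₁x+α₂)` on `[0,1]`
with `a ≤ |φ| ≤ b`, `|φ'| ≤ b`, `0 < a < b` and `α₁ ≠ 0`, then
`|∫₀¹ e^{2πiψ}| ≤ 6 b a^{-3/2} |α₁|^{-1/2}`. -/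
theorem stationary_phase_one
    (ψ φ φd : ℝ → ℝ) (α₁ α₂ a b : ℝ) (ha : 0 < a) (hab : a < b)
    (hψ : ∀ x ∈ Set.Icc (0:ℝ) 1,
      HasDerivWithinAt ψ (φ x * (α₁ * x + α₂)) (Set.Icc 0 1) x)
    (hφd : ∀ x ∈ Set.Icc (0:ℝ) 1, HasDerivWithinAt φ (φd x) (Set.Icc 0 1) x)
    (hφdc : ContinuousOn φd (Set.Icc 0 1))
    (hφa : ∀ x ∈ Set.Icc (0:ℝ) 1, a ≤ |φ x|)
    (hφb : ∀ x ∈ Set.Icc (0:ℝ) 1, |φ x| ≤ b)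
    (hφdb : ∀ x ∈ Set.Icc (0:ℝ) 1, |φd x| ≤ b)
    (hα₁ : α₁ ≠ 0) :
    ‖∫ x in Set.Icc (0:ℝ) 1, Complex.exp ((2 * Real.pi * ψ x : ℝ) * Complex.I)‖ ≤
      6 * b * a ^ (-(3:ℝ)/2) * |α₁| ^ (-(1:ℝ)/2) := by
  have hb : 0 < b := ha.trans hab
  have hα : 0 < |α₁| := abs_pos.2 hα₁
  set c : ℝ := -α₂ / α₁ with hc
  set δ : ℝ := a ^ (-(1:ℝ)/2) * |α₁| ^ (-(1:ℝ)/2) with hδdef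
  have hδ : 0 < δ := by positivity
  have hsq : ∀ y : ℝ, 0 < y → (y ^ (-(1:ℝ)/2)) ^ 2 * y = 1 := by
    intro y hy
    rw [← Real.rpow_natCast, ← Real.rpow_mul hy.le]
    norm_num
    rw [Real.rpow_neg_one, inv_mul_cancel₀ hy.ne']
  have hδα : δ ^ 2 * a * |α₁| = 1 := by
    calc δ ^ 2 * a * |α₁|
        = ((a ^ (-(1:ℝ)/2)) ^ 2 * a) * ((|α₁| ^ (-(1:ℝ)/2)) ^ 2 * |α₁|) := by
          rw [hδdef]; ring
      _ = 1 := by rw [hsq a ha, hsq _ hα, one_mul]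
  have hRHS : 6 * b * a ^ (-(3:ℝ)/2) * |α₁| ^ (-(1:ℝ)/2) = 6 * (b * δ / a) := by
    have : a ^ (-(3:ℝ)/2) = a ^ (-(1:ℝ)/2) / a := by
      rw [← Real.rpow_sub_one ha.ne']
      norm_num
    rw [this, hδdef]
    ring
  have hψ' : ∀ x ∈ Icc (0:ℝ) 1, HasDerivWithinAt ψ (φ x * (α₁ * (x - c))) (Icc 0 1) x := by
    intro x hx
    have : α₁ * (x - c) = α₁ * x + α₂ := by
      rw [hc]; field_simp; ring
    rw [this]
    exact hψ x hx
  have hψc : ContinuousOn ψ (Icc 0 1) := fun x hx => (hψ x hx).continuousWithinAt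
  set e : ℝ → ℂ := fun x => Complex.exp ((2 * Real.pi * ψ x : ℝ) * Complex.I) with he
  have hec : ContinuousOn e (Icc 0 1) := by
    simp only [he]
    fun_prop
  set p : ℝ := max 0 (min 1 (c - δ)) with hp
  set q : ℝ := max 0 (min 1 (c + δ)) with hq
  have hp0 : 0 ≤ p := le_max_left _ _
  have hq1 : q ≤ 1 := max_le zero_le_one (min_le_left _ _)
  have hpq : p ≤ q := max_le_max le_rfl (min_le_min le_rfl (by linarith))
  have hqp : q - p ≤ 2 * δ := by
    rw [hp, hq]
    rcases max_cases 0 (min 1 (c - δ)) with h1 | h1 <;>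
      rcases max_cases 0 (min 1 (c + δ)) with h2 | h2 <;>
      rcases min_cases 1 (c - δ) with h3 | h3 <;>
      rcases min_cases 1 (c + δ) with h4 | h4 <;> linarith
  have hint : ∀ u v : ℝ, 0 ≤ u → u ≤ v → v ≤ 1 → IntervalIntegrable e volume u v :=
    fun u v hu huv hv => (hec.mono (Icc_subset_Icc hu hv)).intervalIntegrable_of_Icc huv
  have hK : 0 < b * δ / a := by positivity
  have hδK : δ ≤ b * δ / a := by
    rw [le_div_iff₀ ha]; nlinarith
  have hleft : ‖∫ x in (0:ℝ)..p, e x‖ ≤ 2 * (b * δ / a) := by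
    rcases hp0.eq_or_lt with h | h
    · rw [← h, intervalIntegral.integral_same, norm_zero]
      positivity
    · refine norm_integral_exp_le_of_le_dist_stationary ha hab hδ hδα le_rfl hp0
        (hpq.trans hq1) hψ' hφd hφdc hφa hφdb fun x hx => ?_
      have hpc : p ≤ c - δ := by
        rcases lt_max_iff.1 h with h | h
        · exact absurd h (lt_irrefl _)
        · rw [hp, max_eq_right h.le]
          exact min_le_right _ _
      rw [abs_sub_comm]
      exact le_trans (by linarith [hx.2]) (le_abs_self _)
  have hright : ‖∫ x in q..(1:ℝ), e x‖ ≤ 2 * (b * δ / a) := by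
    rcases hq1.eq_or_lt with h | h
    · rw [h, intervalIntegral.integral_same, norm_zero]
      positivity
    · refine norm_integral_exp_le_of_le_dist_stationary ha hab hδ hδα (hp0.trans hpq) hq1
        le_rfl hψ' hφd hφdc hφa hφdb fun x hx => ?_
      have hqc : c + δ ≤ q := by
        have h1 : min 1 (c + δ) < 1 := (le_max_right _ _).trans_lt h
        rcases min_lt_iff.1 h1 with h2 | h2
        · exact absurd h2 (lt_irrefl _)
        · rw [hq, min_eq_right h2.le]
          exact le_max_right _ _
      exact le_trans (by linarith [hx.1]) (le_abs_self _)
  have hmid : ‖∫ x in p..q, e x‖ ≤ 2 * (b * δ / a) := by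
    have h := intervalIntegral.norm_integral_le_of_norm_le_const (a := p) (b := q) (f := e)
      (C := 1) fun x _ => (Complex.norm_exp_ofReal_mul_I _).le
    rw [abs_of_nonneg (sub_nonneg.2 hpq)] at h
    linarith
  rw [hRHS, integral_Icc_eq_integral_Ioc, ← intervalIntegral.integral_of_le zero_le_one,
    ← intervalIntegral.integral_add_adjacent_intervals
      (hint 0 q le_rfl (hp0.trans hpq) hq1) (hint q 1 (hp0.trans hpq) hq1 le_rfl),
    ← intervalIntegral.integral_add_adjacent_intervals
      (hint 0 p le_rfl hp0 (hpq.trans hq1)) (hint p q hp0 hpq hq1)]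
  linarith [norm_add₃_le (a := ∫ x in (0:ℝ)..p, e x) (b := ∫ x in p..q, e x)
    (c := ∫ x in q..(1:ℝ), e x)]
end

section
/- Let ψ : [0,1] → ℝ be a C² map whose derivative has the form ψ′(x) = φ(x)·(α₁x + α₂) for some C¹ map φ : [0,1] → ℝ satisfying a ≤ |φ(x)| ≤ b and |φ′(x)| ≤ b for all x ∈ [0,1], where b > a > 0. If |α₁| ≤ |α₂|/2 and α₂ ≠ 0, then |∫₀¹ e^{2πiψ(x)} dx| ≤ 8 |α₂|^{−1} (a^{−1} + b a^{−2}). -/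
open MeasureTheory Filter Set Topology
open scoped ENNReal NNReal Classical Real

/-- First-derivative test: if `ψ' = g` on `[0,1]` with `|g| ≥ c > 0` and `|(1/g)'| ≤ K`, then
`2π |∫₀¹ e^{2πiψ}| ≤ 2 / c + K`. -/
theorem two_pi_mul_norm_integral_exp_le {ψ g gd : ℝ → ℝ} {c K : ℝ} (hc : 0 < c)
    (hψ : ∀ x ∈ Set.Icc (0:ℝ) 1, HasDerivWithinAt ψ (g x) (Set.Icc 0 1) x)
    (hg : ∀ x ∈ Set.Icc (0:ℝ) 1, HasDerivWithinAt g (gd x) (Set.Icc 0 1) x)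
    (hgd : ContinuousOn gd (Set.Icc 0 1))
    (hgc : ∀ x ∈ Set.Icc (0:ℝ) 1, c ≤ |g x|)
    (hK : ∀ x ∈ Set.Icc (0:ℝ) 1, |gd x / g x ^ 2| ≤ K) :
    2 * Real.pi * ‖∫ x in (0:ℝ)..1, Complex.exp ((2 * Real.pi * ψ x : ℝ) * Complex.I)‖ ≤
      2 / c + K := by
  have hg0 : ∀ x ∈ Set.Icc (0:ℝ) 1, g x ≠ 0 := fun x hx =>
    abs_pos.1 (hc.trans_le (hgc x hx))
  have hgcont : ContinuousOn g (Set.Icc 0 1) := fun x hx => (hg x hx).continuousWithinAt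
  set v : ℝ → ℂ := fun x => Complex.exp ((2 * Real.pi * ψ x : ℝ) * Complex.I) with hv_def
  set u : ℝ → ℂ := fun x => (((g x)⁻¹ : ℝ) : ℂ) with hu_def
  set u' : ℝ → ℂ := fun x => ((-gd x / g x ^ 2 : ℝ) : ℂ) with hu'_def
  set v' : ℝ → ℂ := fun x => v x * ((2 * Real.pi * g x : ℝ) * Complex.I) with hv'_def
  have hu : ∀ x ∈ Set.Icc (0:ℝ) 1, HasDerivWithinAt u (u' x) (Set.Icc 0 1) x := fun x hx =>
    ((hg x hx).inv (hg0 x hx)).ofReal_comp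
  have hv : ∀ x ∈ Set.Icc (0:ℝ) 1, HasDerivWithinAt v (v' x) (Set.Icc 0 1) x := fun x hx =>
    (((hψ x hx).const_mul (2 * Real.pi)).ofReal_comp.mul_const Complex.I).cexp
  have hvcont : ContinuousOn v (Set.Icc 0 1) := fun x hx => (hv x hx).continuousWithinAt
  have hu'cont : ContinuousOn u' (Set.Icc 0 1) :=
    Complex.continuous_ofReal.comp_continuousOn
      (hgd.neg.div (hgcont.pow 2) fun x hx => pow_ne_zero 2 (hg0 x hx))
  have hv'cont : ContinuousOn v' (Set.Icc 0 1) :=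
    hvcont.mul ((Complex.continuous_ofReal.comp_continuousOn
      (continuousOn_const.mul hgcont)).mul continuousOn_const)
  have hnv : ∀ x, ‖v x‖ = 1 := fun x => Complex.norm_exp_ofReal_mul_I _
  have hI : Set.uIcc (0:ℝ) 1 = Set.Icc 0 1 := Set.uIcc_of_le zero_le_one
  have hparts : ∫ x in (0:ℝ)..1, u x * v' x =
      u 1 * v 1 - u 0 * v 0 - ∫ x in (0:ℝ)..1, u' x * v x := by
    apply intervalIntegral.integral_mul_deriv_eq_deriv_mul_of_hasDerivWithinAt
    · rwa [hI]
    · rwa [hI]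
    · exact ContinuousOn.intervalIntegrable (by rwa [hI])
    · exact ContinuousOn.intervalIntegrable (by rwa [hI])
  have hmain : ∫ x in (0:ℝ)..1, u x * v' x =
      ((2 * Real.pi : ℝ) * Complex.I) * ∫ x in (0:ℝ)..1, v x := by
    rw [← intervalIntegral.integral_const_mul]
    refine intervalIntegral.integral_congr fun x hx => ?_
    have h0 : (g x : ℂ) ≠ 0 := by exact_mod_cast hg0 x (hI ▸ hx)
    simp only [hu_def, hv'_def]
    push_cast
    field_simp
  have hbd : ∀ x ∈ Set.Icc (0:ℝ) 1, ‖u x * v x‖ ≤ 1 / c := by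
    intro x hx
    rw [norm_mul, hnv, mul_one, Complex.norm_real, Real.norm_eq_abs, abs_inv, ← one_div]
    exact one_div_le_one_div_of_le hc (hgc x hx)
  have hint : ‖∫ x in (0:ℝ)..1, u' x * v x‖ ≤ K := by
    have h := intervalIntegral.norm_integral_le_of_norm_le_const (a := (0:ℝ)) (b := 1)
      (f := fun x => u' x * v x) (C := K) fun x hx => by
        rw [Set.uIoc_of_le zero_le_one] at hx
        rw [norm_mul, hnv, mul_one, Complex.norm_real, Real.norm_eq_abs, neg_div, abs_neg]
        exact hK x ⟨hx.1.le, hx.2⟩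
    simpa using h
  have hnorm : ‖((2 * Real.pi : ℝ) * Complex.I : ℂ)‖ = 2 * Real.pi := by
    rw [norm_mul, Complex.norm_I, mul_one, Complex.norm_real, Real.norm_eq_abs,
      abs_of_pos Real.two_pi_pos]
  calc 2 * Real.pi * ‖∫ x in (0:ℝ)..1, v x‖
      = ‖u 1 * v 1 - u 0 * v 0 - ∫ x in (0:ℝ)..1, u' x * v x‖ := by
        rw [← hparts, hmain, norm_mul, hnorm]
    _ ≤ ‖u 1 * v 1‖ + ‖u 0 * v 0‖ + ‖∫ x in (0:ℝ)..1, u' x * v x‖ :=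
        (norm_sub_le _ _).trans (add_le_add_left (norm_sub_le _ _) _)
    _ ≤ 1 / c + 1 / c + K :=
        add_le_add (add_le_add (hbd 1 (by simp)) (hbd 0 (by simp))) hint
    _ = 2 / c + K := by ring

/-- Stationary phase, second form: if `ψ' = φ·(α₁x+α₂)` on `[0,1]`
with `a ≤ |φ| ≤ b`, `|φ'| ≤ b`, `0 < a < b`, `|α₁| ≤ |α₂|/2` and `α₂ ≠ 0`, then
`|∫₀¹ e^{2πiψ}| ≤ 8 |α₂|⁻¹ (a⁻¹ + b a⁻²)`. -/
theorem stationary_phase_two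
    (ψ φ φd : ℝ → ℝ) (α₁ α₂ a b : ℝ) (ha : 0 < a) (hab : a < b)
    (hψ : ∀ x ∈ Set.Icc (0:ℝ) 1,
      HasDerivWithinAt ψ (φ x * (α₁ * x + α₂)) (Set.Icc 0 1) x)
    (hφd : ∀ x ∈ Set.Icc (0:ℝ) 1, HasDerivWithinAt φ (φd x) (Set.Icc 0 1) x)
    (hφdc : ContinuousOn φd (Set.Icc 0 1))
    (hφa : ∀ x ∈ Set.Icc (0:ℝ) 1, a ≤ |φ x|)
    (hφb : ∀ x ∈ Set.Icc (0:ℝ) 1, |φ x| ≤ b)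
    (hφdb : ∀ x ∈ Set.Icc (0:ℝ) 1, |φd x| ≤ b)
    (hα : |α₁| ≤ |α₂| / 2) (hα₂ : α₂ ≠ 0) :
    ‖∫ x in Set.Icc (0:ℝ) 1, Complex.exp ((2 * Real.pi * ψ x : ℝ) * Complex.I)‖ ≤
      8 * |α₂|⁻¹ * (a⁻¹ + b / a ^ 2) := by
  have hm : 0 < |α₂| / 2 := half_pos (abs_pos.2 hα₂)
  set m := |α₂| / 2 with hm_def
  have hb : 0 < b := ha.trans hab
  have hL : ∀ x ∈ Set.Icc (0:ℝ) 1, m ≤ |α₁ * x + α₂| := by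
    intro x hx
    have h1 : |α₁ * x| ≤ m := by
      rw [abs_mul, abs_of_nonneg hx.1]
      exact (mul_le_of_le_one_right (abs_nonneg _) hx.2).trans hα
    have h2 : |α₂| ≤ |α₁ * x + α₂| + |α₁ * x| := by
      simpa using abs_sub (α₁ * x + α₂) (α₁ * x)
    linarith
  have hLd : ∀ x : ℝ, HasDerivWithinAt (fun x => α₁ * x + α₂) α₁ (Set.Icc 0 1) x := fun x => by
    simpa using ((hasDerivWithinAt_id x (Set.Icc 0 1)).const_mul α₁).add_const α₂
  have hφc : ContinuousOn φ (Set.Icc 0 1) := fun x hx => (hφd x hx).continuousWithinAt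
  have key := two_pi_mul_norm_integral_exp_le (ψ := ψ) (g := fun x => φ x * (α₁ * x + α₂))
    (gd := fun x => φd x * (α₁ * x + α₂) + φ x * α₁) (c := a * m)
    (K := b / (a ^ 2 * m) + 1 / (a * m)) (mul_pos ha hm) hψ
    (fun x hx => (hφd x hx).mul (hLd x)) (by fun_prop)
    (fun x hx => by
      rw [abs_mul]
      exact mul_le_mul (hφa x hx) (hL x hx) hm.le (abs_nonneg _))
    (fun x hx => by
      have hφ0 : φ x ≠ 0 := abs_pos.1 (ha.trans_le (hφa x hx))
      have hL0 : α₁ * x + α₂ ≠ 0 := abs_pos.1 (hm.trans_le (hL x hx))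
      have hsplit : (φd x * (α₁ * x + α₂) + φ x * α₁) / (φ x * (α₁ * x + α₂)) ^ 2 =
          φd x / (φ x ^ 2 * (α₁ * x + α₂)) + α₁ / (φ x * (α₁ * x + α₂) ^ 2) := by
        field_simp
      have hmm : 1 / (a * m) = m / (a * m ^ 2) := by field_simp
      rw [hsplit, hmm]
      refine (abs_add_le _ _).trans (add_le_add ?_ ?_)
      · rw [abs_div, abs_mul, abs_pow]
        have := hφa x hx
        have := hL x hx
        have := hφdb x hx
        gcongr
      · rw [abs_div, abs_mul, abs_pow]
        have := hφa x hx
        have := hL x hx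
        gcongr)
  rw [MeasureTheory.integral_Icc_eq_integral_Ioc,
    ← intervalIntegral.integral_of_le zero_le_one]
  have hα : |α₂| = 2 * m := by rw [hm_def]; ring
  have hrhs : 8 * |α₂|⁻¹ * (a⁻¹ + b / a ^ 2) = 4 * (1 / (a * m)) + 4 * (b / (a ^ 2 * m)) := by
    rw [hα]
    field_simp
    ring
  have h2 : 2 / (a * m) = 2 * (1 / (a * m)) := by ring
  have p1 : 0 < 1 / (a * m) := by positivity
  have p2 : 0 < b / (a ^ 2 * m) := by positivity
  rw [hrhs]
  rw [h2] at key
  have hpi := Real.pi_gt_three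
  set N := ‖∫ x in (0:ℝ)..1, Complex.exp ((2 * Real.pi * ψ x : ℝ) * Complex.I)‖
  have hN : 0 ≤ N := norm_nonneg _
  nlinarith [mul_nonneg (sub_nonneg.2 hpi.le) hN]
end

section
/- Let n ∈ ℕ and let 𝐚, 𝐛 ∈ ℕⁿ be finite words of continued fraction digits. If the continuants satisfy qₙ(𝐚) = qₙ(𝐛) and q_{n−1}(𝐚) = q_{n−1}(𝐛), then 𝐚 = 𝐛. -/
open MeasureTheory Filter Set Topology
open scoped ENNReal NNReal Classical Real

theorem contPQ_append_pair (l : List ℕ) (a b : ℕ) :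
    contPQ (l ++ [a, b]) = b • contPQ (l ++ [a]) + contPQ l := by
  induction l with
  | nil => ext <;> simp [contPQ]; ring
  | cons c l ih =>
    ext <;> simp only [List.cons_append, contPQ, ih, Prod.fst_add, Prod.snd_add, Prod.smul_fst,
      Prod.smul_snd, smul_eq_mul]
    ring

theorem contQ_append_pair (l : List ℕ) (a b : ℕ) :
    contQ (l ++ [a, b]) = b * contQ (l ++ [a]) + contQ l := by
  simp [contQ, contPQ_append_pair]

theorem contQ_pos (l : List ℕ) (h : ∀ a ∈ l, 0 < a) : 0 < contQ l := by
  induction l with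
  | nil => simp [contQ, contPQ]
  | cons a l ih =>
    rw [List.forall_mem_cons] at h
    exact Nat.add_pos_left (Nat.mul_pos h.1 (ih h.2)) _

theorem contQ_le_append_singleton (l : List ℕ) {a : ℕ} (ha : 0 < a) :
    contQ l ≤ contQ (l ++ [a]) := by
  rcases List.eq_nil_or_concat' l with rfl | ⟨l, c, rfl⟩
  · simpa [contQ, contPQ] using Nat.succ_le_of_lt ha
  · rw [List.append_assoc, List.singleton_append, contQ_append_pair]
    nlinarith

/-- Division with remainder in `{1, …, q}` is unique. -/
theorem eq_of_mul_add_eq_mul_add {q r s a b : ℕ} (hr : 0 < r) (hrq : r ≤ q) (hs : 0 < s)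
    (hsq : s ≤ q) (h : a * q + r = b * q + s) : a = b := by
  rcases lt_trichotomy a b with hab | hab | hab
  · nlinarith
  · exact hab
  · nlinarith

theorem append_singleton_eq_of_contQ_eq (l m : List ℕ) (a b : ℕ) (hlen : l.length = m.length)
    (hl : ∀ x ∈ l, 0 < x) (hm : ∀ x ∈ m, 0 < x)
    (hq : contQ (l ++ [a]) = contQ (m ++ [b])) (hq' : contQ l = contQ m) :
    l ++ [a] = m ++ [b] := by
  induction l using List.reverseRecOn generalizing m a b with
  | nil =>
    obtain rfl : m = [] := List.length_eq_zero_iff.mp hlen.symm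
    simpa [contQ, contPQ] using hq
  | append_singleton l c ih =>
    rcases List.eq_nil_or_concat' m with rfl | ⟨m, d, rfl⟩
    · simp at hlen
    simp only [List.length_append, List.length_singleton, Nat.add_right_cancel_iff] at hlen
    simp only [List.forall_mem_append, List.forall_mem_singleton] at hl hm
    rw [List.append_assoc, List.append_assoc, List.singleton_append, List.singleton_append,
      contQ_append_pair, contQ_append_pair, ← hq'] at hq
    obtain rfl : a = b := eq_of_mul_add_eq_mul_add (contQ_pos l hl.1)
      (contQ_le_append_singleton l hl.2) (contQ_pos m hm.1)
      (hq' ▸ contQ_le_append_singleton m hm.2) hq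
    rw [ih m c d hlen hl.1 hm.1 hq' (Nat.add_left_cancel hq)]

/-- Two words of the same length with the same continuants
`qₙ` and `q_{n-1}` are equal. -/
theorem continuants_determine_word
    (l₁ l₂ : List ℕ) (hlen : l₁.length = l₂.length) (h0 : 0 < l₁.length)
    (hpos₁ : ∀ a ∈ l₁, 0 < a) (hpos₂ : ∀ a ∈ l₂, 0 < a)
    (hq : contQ l₁ = contQ l₂) (hq' : contQ l₁.dropLast = contQ l₂.dropLast) :
    l₁ = l₂ := by
  rcases List.eq_nil_or_concat' l₁ with rfl | ⟨l, a, rfl⟩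
  · simp at h0
  rcases List.eq_nil_or_concat' l₂ with rfl | ⟨m, b, rfl⟩
  · simp at hlen
  simp only [List.dropLast_concat] at hq'
  simp only [List.length_append, List.length_singleton, Nat.add_right_cancel_iff] at hlen
  simp only [List.forall_mem_append] at hpos₁ hpos₂
  exact append_singleton_eq_of_contQ_eq l m a b hlen hpos₁.1 hpos₂.1 hq hq'
end
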